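/- The exponential automorphism φ = exp Δ of k[x1,x2,x3] is not co-tame; that is, the subgroup ⟨φ, Aff_3(k)⟩ of the automorphism group of k[x1,x2,x3] does not contain the tame subgroup TA_3(k). -/

import Mathlib

open MvPolynomial

noncomputable section

namespace YasudaPaper

variable {k : Type*} [Field k]

/-- `f := x1*x3 - x2^2` (variables: `X 0 = x1, X 1 = x2, X 2 = x3`). -/
def fP : MvPolynomial (Fin 3) k := X 0 * X 2 - X 1 ^ 2

/-- `r := x2*f + x1^2`. -/
def rP : MvPolynomial (Fin 3) k := X 1 * fP + X 0 ^ 2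

/-- `g := x3*f^2 + 2*x1*x2*f + x1^3`. -/
def gP : MvPolynomial (Fin 3) k := X 2 * fP ^ 2 + 2 * X 0 * X 1 * fP + X 0 ^ 3

/-- The Jacobian derivation `Δ = Δ_{(f,g)}`, `h ↦ det ∂(f,g,h)/∂(x1,x2,x3)`. -/
def Del (h : MvPolynomial (Fin 3) k) : MvPolynomial (Fin 3) k :=
  Matrix.det !![pderiv 0 fP, pderiv 1 fP, pderiv 2 fP;
                pderiv 0 gP, pderiv 1 gP, pderiv 2 gP;
                pderiv 0 h,  pderiv 1 h,  pderiv 2 h]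

/-- `φ = exp D`: for every `h` and every `N` with `D^[N] h = 0`,
    `φ h = ∑_{i<N} D^i(h)/i!`.  (For a locally nilpotent `D` this characterizes
    the exponential automorphism.) -/
def IsExpOf {σ : Type*} (D : MvPolynomial σ k → MvPolynomial σ k)
    (φ : MvPolynomial σ k ≃ₐ[k] MvPolynomial σ k) : Prop :=
  ∀ (h : MvPolynomial σ k) (N : ℕ), D^[N] h = 0 →
    φ h = ∑ i ∈ Finset.range N, (Nat.factorial i : k)⁻¹ • D^[i] h

/-- `α` is an affine automorphism: `α(x_i) = ∑_j a_{j,i} x_j + b_i` with `A ∈ GL₃(k)`. -/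
def IsAffine (α : MvPolynomial (Fin 3) k ≃ₐ[k] MvPolynomial (Fin 3) k) : Prop :=
  ∃ (A : Matrix (Fin 3) (Fin 3) k) (b : Fin 3 → k), IsUnit A.det ∧
    ∀ i : Fin 3, α (X i) = (∑ j : Fin 3, C (A j i) * X j) + C (b i)

/-- `Aff_3(k)` as a set of automorphisms. -/
def AffSet : Set (MvPolynomial (Fin 3) k ≃ₐ[k] MvPolynomial (Fin 3) k) := {α | IsAffine α}

/-- `α` is a triangular automorphism: `α(x_i) = a_i x_i + f_i(x_1,…,x_{i-1})`, `a_i ≠ 0`. -/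
def IsTriangular (α : MvPolynomial (Fin 3) k ≃ₐ[k] MvPolynomial (Fin 3) k) : Prop :=
  ∃ (a : Fin 3 → k) (p : Fin 3 → MvPolynomial (Fin 3) k),
    (∀ i, a i ≠ 0) ∧ (∀ i, p i ∈ MvPolynomial.supported k {j | j < i}) ∧
    (∀ i, α (X i) = C (a i) * X i + p i)

/-- `BA_3(k)` as a set of automorphisms. -/
def TriSet : Set (MvPolynomial (Fin 3) k ≃ₐ[k] MvPolynomial (Fin 3) k) := {α | IsTriangular α}

/-- The tame subgroup `TA_3(k) = ⟨Aff_3(k), BA_3(k)⟩`. -/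
def TA : Subgroup (MvPolynomial (Fin 3) k ≃ₐ[k] MvPolynomial (Fin 3) k) :=
  Subgroup.closure (AffSet ∪ TriSet)

/-- `β = β_u = (u^3 x1, u^2 x2, u x3)`. -/
def IsBeta (u : k) (β : MvPolynomial (Fin 3) k ≃ₐ[k] MvPolynomial (Fin 3) k) : Prop :=
  β (X 0) = C (u ^ 3) * X 0 ∧ β (X 1) = C (u ^ 2) * X 1 ∧ β (X 2) = C u * X 2

/-- `B = {β_u | u ∈ k^*}`. -/
def BSet : Set (MvPolynomial (Fin 3) k ≃ₐ[k] MvPolynomial (Fin 3) k) :=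
  {β | ∃ u : k, u ≠ 0 ∧ IsBeta u β}

/-! Six-variable ring `k[x1,x2,x3,t_r,t_f,t_g]`:
variables `X 0 = x1, X 1 = x2, X 2 = x3, X 3 = t_r, X 4 = t_f, X 5 = t_g`. -/

/-- The inclusion of variable index sets. -/
def ι36 : Fin 3 → Fin 6 := Fin.castLE (by norm_num)

/-- The embedding `k[x1,x2,x3] → k[x1,x2,x3,t_r,t_f,t_g]`. -/
def embP : MvPolynomial (Fin 3) k →ₐ[k] MvPolynomial (Fin 6) k := rename ι36

/-- The substitution map `π : t_r ↦ r, t_f ↦ f, t_g ↦ g` (fixing `x1,x2,x3`). -/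
def piMap : MvPolynomial (Fin 6) k →ₐ[k] MvPolynomial (Fin 3) k :=
  aeval ![X 0, X 1, X 2, rP, fP, gP]

/-- The triangular derivation
`Δ' = -2 t_r t_f ∂/∂x1 + (4 x1 t_r - t_g) ∂/∂x2 + (6 x2 t_r + 2 t_f²) ∂/∂x3 - t_f t_g ∂/∂t_r`. -/
def Del' (p : MvPolynomial (Fin 6) k) : MvPolynomial (Fin 6) k :=
  (-(2 * X 3 * X 4)) * pderiv 0 p + (4 * X 0 * X 3 - X 5) * pderiv 1 p +
  (6 * X 1 * X 3 + 2 * X 4 ^ 2) * pderiv 2 p + (-(X 4 * X 5)) * pderiv 3 p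

/-- The weight `w1 = (1,2,3,1,0,1)`. -/
def w1 : Fin 6 → ℕ := ![1, 2, 3, 1, 0, 1]

/-- The weight `w2 = (0,0,0,0,1,0)`. -/
def w2 : Fin 6 → ℕ := ![0, 0, 0, 0, 1, 0]

/-- The sixth cyclic lexicographic order on exponent vectors: first compare the
exponent of `t_g`, then lexicographically the exponents of `x1,x2,x3,t_r,t_f`. -/
def cyclicLt (a b : Fin 6 →₀ ℕ) : Prop :=
  a 5 < b 5 ∨ (a 5 = b 5 ∧ ∃ m : Fin 5,
    (∀ l : Fin 5, l < m → a l.castSucc = b l.castSucc) ∧ a m.castSucc < b m.castSucc)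

/-- The leading monomial of `p` (for the sixth cyclic lexicographic order) is `m`. -/
def LeadMonIs (p : MvPolynomial (Fin 6) k) (m : Fin 6 →₀ ℕ) : Prop :=
  m ∈ p.support ∧ ∀ m' ∈ p.support, m' ≠ m → cyclicLt m' m

/-- The exponent vector of the monomial `t_f^δ t_g^γ`. -/
def tfMon (γ δ : ℕ) : Fin 6 →₀ ℕ := Finsupp.single 4 δ + Finsupp.single 5 γ

/-- The set `P_{γ,δ}`. -/
def Pset (γ δ : ℕ) : Set (MvPolynomial (Fin 6) k) :=
  {p | p ≠ 0 ∧ weightedTotalDegree w1 p ≤ γ ∧ weightedTotalDegree w2 p ≤ δ ∧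
    LeadMonIs p (tfMon γ δ)}

/-- `α'` is a lift of `α`. -/
def IsLift (α : MvPolynomial (Fin 3) k ≃ₐ[k] MvPolynomial (Fin 3) k)
    (α' : MvPolynomial (Fin 6) k →ₐ[k] MvPolynomial (Fin 6) k) : Prop :=
  (∀ i : Fin 3, α' (X (ι36 i)) = embP (α (X i))) ∧
  (∀ p, piMap (α' p) = α (piMap p))

/-- `t = γ_j = max {i | a_{i,j} ≠ 0}` (with rows indexed `1,2,3`). -/
def TypeIs (A : Matrix (Fin 3) (Fin 3) k) (j : Fin 3) (t : ℕ) : Prop :=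
  ∃ i : Fin 3, t = (i : ℕ) + 1 ∧ A i j ≠ 0 ∧ ∀ i' : Fin 3, i < i' → A i' j = 0

/-- Condition (C) for a lift `α'` of an affine automorphism of type `(γ1,γ2,γ3)`,
relative to `φ' = exp(uΔ')`. -/
def CondC (γ1 γ2 γ3 : ℕ) (φ' : MvPolynomial (Fin 6) k ≃ₐ[k] MvPolynomial (Fin 6) k)
    (α' : MvPolynomial (Fin 6) k →ₐ[k] MvPolynomial (Fin 6) k) : Prop :=
  ∃ m4 m5 m6 n4 n5 n6 : ℕ,
    1 ≤ n4 ∧ 1 ≤ n5 ∧ 1 ≤ n6 ∧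
    φ' (α' (X 3)) ∈ Pset m4 n4 ∧
    φ' (α' (X 4)) ∈ Pset m5 n5 ∧
    φ' (α' (X 5)) ∈ Pset m6 n6 ∧
    γ1 ≤ m6 ∧ γ2 ≤ 2 * m6 ∧ γ3 ≤ 3 * m6 ∧ m4 ≤ m6 ∧
    γ1 + 1 ≤ n6 - 1 ∧ γ2 + 1 ≤ 2 * (n6 - 1) ∧ γ3 + 1 ≤ 3 * (n6 - 1) ∧ n4 ≤ n6 - 1

/-- The image of `x_j` under the affine map given by `(A, d)`, inside the six-variable ring. -/
def affImg (A : Matrix (Fin 3) (Fin 3) k) (d : Fin 3 → k) (j : Fin 3) :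
    MvPolynomial (Fin 6) k :=
  (∑ i : Fin 3, C (A i j) * X (ι36 i)) + C (d j)

/-- The image of `t_f` under the lift `α̂`:
`α̂(t_f) = α(f) + (a_{1,1}a_{3,3} - 2a_{1,2}a_{3,2} + a_{1,3}a_{3,1})(t_f - f)`. -/
def hatTf (A : Matrix (Fin 3) (Fin 3) k) (d : Fin 3 → k) : MvPolynomial (Fin 6) k :=
  (affImg A d 0 * affImg A d 2 - affImg A d 1 ^ 2) +
    C (A 0 0 * A 2 2 - 2 * (A 0 1 * A 2 1) + A 0 2 * A 2 0) *
      (X 4 - (X 0 * X 2 - X 1 ^ 2))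

/-- The lift `α̂` of the affine automorphism given by `(A, d)`:
`α̂(x_i) = α(x_i)`, `α̂(t_f)` as in `hatTf`, `α̂(t_r) = α̂(x2 t_f + x1²)`,
`α̂(t_g) = α̂(x3 t_f² + 2 x1 x2 t_f + x1³)`. -/
def hatLift (A : Matrix (Fin 3) (Fin 3) k) (d : Fin 3 → k) :
    MvPolynomial (Fin 6) k →ₐ[k] MvPolynomial (Fin 6) k :=
  aeval ![affImg A d 0, affImg A d 1, affImg A d 2,
    affImg A d 1 * hatTf A d + affImg A d 0 ^ 2,
    hatTf A d,
    affImg A d 2 * hatTf A d ^ 2 + 2 * affImg A d 0 * affImg A d 1 * hatTf A d +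
      affImg A d 0 ^ 3]

/-- The exponential `exp (uΔ)`, given by its values on the variables. -/
def expHom (u : k) : MvPolynomial (Fin 3) k →ₐ[k] MvPolynomial (Fin 3) k :=
  aeval ![X 0 - 2 * C u * rP * fP + C u ^ 2 * fP ^ 2 * gP,
    X 1 + C u * (4 * X 0 * rP - gP) - C u ^ 2 * (4 * rP ^ 2 * fP + 2 * X 0 * fP * gP)
      + 4 * C u ^ 3 * rP * fP ^ 2 * gP - C u ^ 4 * fP ^ 3 * gP ^ 2,
    X 2 + C u * (6 * X 1 * rP + 2 * fP ^ 2)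
      + C u ^ 2 * (12 * X 0 * rP ^ 2 - 3 * rP * gP - 3 * X 1 * fP * gP)
      - C u ^ 3 * (8 * rP ^ 3 * fP + 12 * X 0 * rP * fP * gP - 2 * fP * gP ^ 2)
      + C u ^ 4 * (12 * rP ^ 2 * fP ^ 2 * gP + 3 * X 0 * fP ^ 2 * gP ^ 2)
      - 6 * C u ^ 5 * rP * fP ^ 3 * gP ^ 2 + C u ^ 6 * fP ^ 4 * gP ^ 3]

lemma expHom_X0 (u : k) : expHom u (X 0) =
    X 0 - 2 * C u * rP * fP + C u ^ 2 * fP ^ 2 * gP := by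
  simp [expHom]

lemma expHom_X1 (u : k) : expHom u (X 1) =
    X 1 + C u * (4 * X 0 * rP - gP) - C u ^ 2 * (4 * rP ^ 2 * fP + 2 * X 0 * fP * gP)
      + 4 * C u ^ 3 * rP * fP ^ 2 * gP - C u ^ 4 * fP ^ 3 * gP ^ 2 := by
  simp [expHom]

lemma expHom_X2 (u : k) : expHom u (X 2) =
    X 2 + C u * (6 * X 1 * rP + 2 * fP ^ 2)
      + C u ^ 2 * (12 * X 0 * rP ^ 2 - 3 * rP * gP - 3 * X 1 * fP * gP)
      - C u ^ 3 * (8 * rP ^ 3 * fP + 12 * X 0 * rP * fP * gP - 2 * fP * gP ^ 2)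
      + C u ^ 4 * (12 * rP ^ 2 * fP ^ 2 * gP + 3 * X 0 * fP ^ 2 * gP ^ 2)
      - 6 * C u ^ 5 * rP * fP ^ 3 * gP ^ 2 + C u ^ 6 * fP ^ 4 * gP ^ 3 := by
  simp [expHom]

lemma algHom_fP {S : Type*} [CommRing S] [Algebra k S] (L : MvPolynomial (Fin 3) k →ₐ[k] S) :
    L fP = L (X 0) * L (X 2) - L (X 1) ^ 2 := by
  simp [fP]

lemma algHom_rP {S : Type*} [CommRing S] [Algebra k S] (L : MvPolynomial (Fin 3) k →ₐ[k] S) :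
    L rP = L (X 1) * L fP + L (X 0) ^ 2 := by
  simp [rP]

lemma algHom_gP {S : Type*} [CommRing S] [Algebra k S] (L : MvPolynomial (Fin 3) k →ₐ[k] S) :
    L gP = L (X 2) * L fP ^ 2 + 2 * L (X 0) * L (X 1) * L fP + L (X 0) ^ 3 := by
  simp only [gP, map_add, map_mul, map_pow, map_ofNat]

lemma X0_mul_gP : (X 0 * gP : MvPolynomial (Fin 3) k) = rP ^ 2 + fP ^ 3 := by
  simp only [gP, rP, fP]; ring

lemma expHom_fP (u : k) : expHom u fP = fP := by
  rw [algHom_fP, expHom_X0, expHom_X1, expHom_X2]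
  have hf : (fP : MvPolynomial (Fin 3) k) = X 0 * X 2 - X 1 ^ 2 := rfl
  have hr : (rP : MvPolynomial (Fin 3) k) = X 1 * fP + X 0 ^ 2 := rfl
  have hg : (gP : MvPolynomial (Fin 3) k) = X 2 * fP ^ 2 + 2 * X 0 * X 1 * fP + X 0 ^ 3 := rfl
  have hx := X0_mul_gP (k := k)
  linear_combination -hf
    + C u * (2 * X 1 * hg - 2 * fP * X 2 * hr - 2 * X 0 * X 1 * hr + 2 * X 0 * fP * hf)
    + C u ^ 2 * (4 * rP ^ 2 * hr - gP * hg + X 0 * gP * hr + 4 * rP * hx)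
    + C u ^ 3 * (-4 * rP * fP * gP * hr - 2 * fP * gP * hx) + C u ^ 4 * fP ^ 2 * gP ^ 2 * hr

lemma expHom_rP (u : k) : expHom u rP = rP - C u * fP * gP := by
  rw [algHom_rP, expHom_fP, expHom_X0, expHom_X1]
  have hr : (rP : MvPolynomial (Fin 3) k) = X 1 * fP + X 0 ^ 2 := rfl
  linear_combination -hr

lemma expHom_gP (u : k) : expHom u gP = gP := by
  rw [algHom_gP, expHom_fP, expHom_X0, expHom_X1, expHom_X2]
  have hr : (rP : MvPolynomial (Fin 3) k) = X 1 * fP + X 0 ^ 2 := rfl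
  have hg : (gP : MvPolynomial (Fin 3) k) = X 2 * fP ^ 2 + 2 * X 0 * X 1 * fP + X 0 ^ 3 := rfl
  have hx := X0_mul_gP (k := k)
  linear_combination -hg + C u * (-2 * rP * fP * hr - 2 * fP * hx) + C u ^ 2 * fP ^ 2 * gP * hr

lemma expHom_comp (u v : k) : (expHom u).comp (expHom v) = expHom (u + v) := by
  apply MvPolynomial.algHom_ext
  intro i
  have hC : expHom u (C v) = C v := (expHom u).commutes v
  fin_cases i
  · simp only [AlgHom.comp_apply, Fin.zero_eta, expHom_X0,
      map_add, map_sub, map_mul, map_pow, map_ofNat, expHom_fP, expHom_rP, expHom_gP, hC]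
    ring
  · simp only [AlgHom.comp_apply, Fin.mk_one, expHom_X0, expHom_X1,
      map_add, map_sub, map_mul, map_pow, map_ofNat, expHom_fP, expHom_rP, expHom_gP, hC]
    ring
  · simp only [AlgHom.comp_apply, Fin.reduceFinMk, expHom_X0, expHom_X1, expHom_X2,
      map_add, map_sub, map_mul, map_pow, map_ofNat, expHom_fP, expHom_rP, expHom_gP, hC]
    ring

lemma expHom_zero : expHom (0 : k) = AlgHom.id k _ := by
  apply MvPolynomial.algHom_ext
  intro i
  fin_cases i <;> simp [expHom]

lemma expHom_comm {w : k} {b : MvPolynomial (Fin 3) k →ₐ[k] MvPolynomial (Fin 3) k}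
    (h0 : b (X 0) = C (w ^ 3) * X 0) (h1 : b (X 1) = C (w ^ 2) * X 1)
    (h2 : b (X 2) = C w * X 2) (u : k) :
    b.comp (expHom u) = (expHom (u * w ^ 7)).comp b := by
  have hf : b fP = C w ^ 4 * fP := by
    rw [algHom_fP, h0, h1, h2, fP]; simp only [map_pow]; ring
  have hr : b rP = C w ^ 6 * rP := by
    rw [algHom_rP, hf, h0, h1, rP]; simp only [map_pow]; ring
  have hg : b gP = C w ^ 9 * gP := by
    rw [algHom_gP, hf, h0, h1, h2, gP]; simp only [map_pow]; ring
  have hC : b (C u) = C u := b.commutes u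
  have hC' (c : k) : expHom (u * w ^ 7) (C c) = C c := (expHom _).commutes c
  apply MvPolynomial.algHom_ext
  intro i
  fin_cases i
  · simp only [AlgHom.comp_apply, Fin.zero_eta, expHom_X0,
      map_add, map_sub, map_mul, map_pow, map_ofNat, hf, hr, hg, hC, h0, hC']
    ring
  · simp only [AlgHom.comp_apply, Fin.mk_one, expHom_X1,
      map_add, map_sub, map_mul, map_pow, map_ofNat, hf, hr, hg, hC, h0, h1, hC']
    ring
  · simp only [AlgHom.comp_apply, Fin.reduceFinMk, expHom_X2,
      map_add, map_sub, map_mul, map_pow, map_ofNat, hf, hr, hg, hC, h0, h1, h2, hC']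
    ring

/-- `Δ` as a bundled derivation. -/
def delDer : Derivation k (MvPolynomial (Fin 3) k) (MvPolynomial (Fin 3) k) :=
  mkDerivation k ![-2 * rP * fP, 4 * X 0 * rP - gP, 6 * X 1 * rP + 2 * fP ^ 2]

lemma Del_eq_delDer (h : MvPolynomial (Fin 3) k) : Del h = delDer h := by
  let E : Derivation k (MvPolynomial (Fin 3) k) (MvPolynomial (Fin 3) k) :=
    (pderiv 1 (fP (k := k)) * pderiv 2 (gP (k := k)) - pderiv 2 (fP (k := k)) * pderiv 1 (gP (k := k))) • pderiv 0
    + (pderiv 2 (fP (k := k)) * pderiv 0 (gP (k := k)) - pderiv 0 (fP (k := k)) * pderiv 2 (gP (k := k))) • pderiv 1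
    + (pderiv 0 (fP (k := k)) * pderiv 1 (gP (k := k)) - pderiv 1 (fP (k := k)) * pderiv 0 (gP (k := k))) • pderiv 2
  have hE (h : MvPolynomial (Fin 3) k) : Del h = E h := by
    rw [Del, Matrix.det_fin_three]
    simp [E]
    ring
  have : E = delDer := by
    have h2 (i : Fin 3) : pderiv i (2 : MvPolynomial (Fin 3) k) = 0 := (pderiv i).map_natCast 2
    apply MvPolynomial.derivation_ext
    intro i
    fin_cases i
    all_goals
      simp [E, delDer, h2, mkDerivation_X, gP, rP, fP, pderiv_X, Derivation.leibniz,
        Derivation.leibniz_pow]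
      ring
  rw [hE, this]

lemma delDer_X0 : delDer (X 0 : MvPolynomial (Fin 3) k) = -2 * rP * fP := by
  simp [delDer, mkDerivation_X]

lemma delDer_X1 : delDer (X 1 : MvPolynomial (Fin 3) k) = 4 * X 0 * rP - gP := by
  simp [delDer, mkDerivation_X]

lemma delDer_X2 : delDer (X 2 : MvPolynomial (Fin 3) k) = 6 * X 1 * rP + 2 * fP ^ 2 := by
  simp [delDer, mkDerivation_X]

lemma delDer_ofNat (n : ℕ) [n.AtLeastTwo] :
    delDer (ofNat(n) : MvPolynomial (Fin 3) k) = 0 :=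
  delDer.map_natCast n

lemma delDer_fP : delDer (fP : MvPolynomial (Fin 3) k) = 0 := by
  rw [fP]
  simp only [map_sub, Derivation.leibniz, Derivation.leibniz_pow, delDer_X0, delDer_X1, delDer_X2]
  simp only [gP, rP, fP, smul_eq_mul, nsmul_eq_mul]
  ring

lemma delDer_rP : delDer (rP : MvPolynomial (Fin 3) k) = -(fP * gP) := by
  rw [rP]
  simp only [map_add, Derivation.leibniz, Derivation.leibniz_pow, delDer_X0, delDer_X1, delDer_fP]
  simp only [rP, smul_eq_mul, nsmul_eq_mul]
  push_cast
  ring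

lemma delDer_gP : delDer (gP : MvPolynomial (Fin 3) k) = 0 := by
  rw [gP]
  simp only [map_add, Derivation.leibniz, Derivation.leibniz_pow, delDer_X0, delDer_X1, delDer_X2,
    delDer_fP, delDer_ofNat]
  simp only [gP, rP, fP, smul_eq_mul, nsmul_eq_mul]
  push_cast
  ring

lemma IsExpOf.apply_eq_sum [CharZero k] {φ : MvPolynomial (Fin 3) k ≃ₐ[k] MvPolynomial (Fin 3) k}
    (hφ : IsExpOf Del φ) (q : ℕ → MvPolynomial (Fin 3) k) (N : ℕ) (hN : q N = 0)
    (hq : ∀ i, delDer (q i) = (i + 1 : ℕ) • q (i + 1)) :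
    φ (q 0) = ∑ i ∈ Finset.range N, q i := by
  have key (i : ℕ) : Del^[i] (q 0) = (Nat.factorial i : k) • q i := by
    induction i with
    | zero => simp
    | succ i ih =>
      rw [Function.iterate_succ_apply', ih, Del_eq_delDer, Derivation.map_smul, hq,
        ← Nat.cast_smul_eq_nsmul k, smul_smul, Nat.factorial_succ]
      push_cast
      rw [mul_comm]
  rw [hφ (q 0) N (by rw [key, hN, smul_zero])]
  refine Finset.sum_congr rfl fun i _ => ?_
  rw [key, smul_smul, inv_mul_cancel₀ (by exact_mod_cast Nat.factorial_ne_zero i), one_smul]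

lemma IsExpOf.eq_expHom [CharZero k] {φ : MvPolynomial (Fin 3) k ≃ₐ[k] MvPolynomial (Fin 3) k}
    (hφ : IsExpOf Del φ) : (φ : MvPolynomial (Fin 3) k →ₐ[k] MvPolynomial (Fin 3) k) =
      expHom 1 := by
  apply MvPolynomial.algHom_ext
  intro i
  fin_cases i
  · let q : ℕ → MvPolynomial (Fin 3) k
      | 0 => X 0
      | 1 => -2 * rP * fP
      | 2 => fP ^ 2 * gP
      | _ => 0
    have h := hφ.apply_eq_sum q 3 rfl fun i => by
      rcases i with _ | _ | _ | i <;>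
      simp only [q, map_neg, map_zero, Derivation.leibniz, Derivation.leibniz_pow, delDer_X0,
        delDer_fP, delDer_rP, delDer_gP, delDer_ofNat, smul_eq_mul, nsmul_eq_mul] <;>
      push_cast <;> ring
    simp only [Finset.sum_range_succ, Finset.sum_range_zero, q] at h
    refine h.trans ((expHom_X0 1).trans ?_).symm
    simp only [map_one]
    ring
  · let q : ℕ → MvPolynomial (Fin 3) k
      | 0 => X 1
      | 1 => 4 * X 0 * rP - gP
      | 2 => -(4 * rP ^ 2 * fP + 2 * X 0 * fP * gP)
      | 3 => 4 * rP * fP ^ 2 * gP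
      | 4 => -(fP ^ 3 * gP ^ 2)
      | _ => 0
    have h := hφ.apply_eq_sum q 5 rfl fun i => by
      rcases i with _ | _ | _ | _ | _ | i <;>
      simp only [q, map_neg, map_zero, map_add, map_sub, Derivation.leibniz,
        Derivation.leibniz_pow, delDer_X0, delDer_X1,
        delDer_fP, delDer_rP, delDer_gP, delDer_ofNat, smul_eq_mul, nsmul_eq_mul] <;>
      push_cast <;> ring
    simp only [Finset.sum_range_succ, Finset.sum_range_zero, q] at h
    refine h.trans ((expHom_X1 1).trans ?_).symm
    simp only [map_one]
    ring
  · let q : ℕ → MvPolynomial (Fin 3) k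
      | 0 => X 2
      | 1 => 6 * X 1 * rP + 2 * fP ^ 2
      | 2 => 12 * X 0 * rP ^ 2 - 3 * rP * gP - 3 * X 1 * fP * gP
      | 3 => -(8 * rP ^ 3 * fP + 12 * X 0 * rP * fP * gP - 2 * fP * gP ^ 2)
      | 4 => 12 * rP ^ 2 * fP ^ 2 * gP + 3 * X 0 * fP ^ 2 * gP ^ 2
      | 5 => -(6 * rP * fP ^ 3 * gP ^ 2)
      | 6 => fP ^ 4 * gP ^ 3
      | _ => 0
    have h := hφ.apply_eq_sum q 7 rfl fun i => by
      rcases i with _ | _ | _ | _ | _ | _ | _ | i <;>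
      simp only [q, map_neg, map_zero, map_add, map_sub, Derivation.leibniz,
        Derivation.leibniz_pow, delDer_X0, delDer_X1, delDer_X2,
        delDer_fP, delDer_rP, delDer_gP, delDer_ofNat, smul_eq_mul, nsmul_eq_mul] <;>
      push_cast <;> ring
    simp only [Finset.sum_range_succ, Finset.sum_range_zero, q] at h
    refine h.trans ((expHom_X2 1).trans ?_).symm
    simp only [map_one]
    ring

section Degree

open Polynomial (natDegree natDegree_mul natDegree_pow natDegree_C natDegree_C_mul
  natDegree_C_mul_le natDegree_mul_le_of_le natDegree_pow_le_of_le
  natDegree_add_eq_left_of_natDegree_lt natDegree_add_le_of_degree_le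
  ne_zero_of_natDegree_gt)

lemma natDegree_add_lt {p q : Polynomial k} {N : ℕ} (hp : natDegree p < N) (hq : natDegree q < N) :
    natDegree (p + q) < N :=
  (Polynomial.natDegree_add_le p q).trans_lt (max_lt hp hq)

lemma natDegree_C_mul_lt {p : Polynomial k} {N : ℕ} (c : k) (hp : natDegree p < N) :
    natDegree (Polynomial.C c * p) < N :=
  (natDegree_C_mul_le c p).trans_lt hp

lemma natDegree_C_lt {N : ℕ} (c : k) (hN : 0 < N) : natDegree (Polynomial.C c) < N := by
  rwa [natDegree_C]

lemma natDegree_C_mul_add {q s : Polynomial k} {N : ℕ} {c : k} (hc : c ≠ 0)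
    (hq : natDegree q = N) (hs : natDegree s < N) :
    natDegree (Polynomial.C c * q + s) = N := by
  have h : natDegree (Polynomial.C c * q) = N := by rw [natDegree_C_mul hc, hq]
  rw [natDegree_add_eq_left_of_natDegree_lt (by rwa [h]), h]

lemma natDegree_mul_pos {p q : Polynomial k} (hp : 0 < natDegree p) (hq : 0 < natDegree q) :
    natDegree (p * q) = natDegree p + natDegree q :=
  natDegree_mul (ne_zero_of_natDegree_gt hp) (ne_zero_of_natDegree_gt hq)

/-- The degrees of the images of `x₁, x₂, x₃, f, r, g` after applying `exp (uΔ)` to a generic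
point, in terms of `n = deg f` and `T = deg f + deg g`. -/
structure Growth (n T : ℕ) (y₁ y₂ y₃ F : Polynomial k) : Prop where
  n_pos : 0 < n
  n_lt : n < T
  deg_F : natDegree F = n
  deg_one : natDegree y₁ = T + n
  deg_two : natDegree y₂ = 2 * T + n
  deg_three : natDegree y₃ = 3 * T + n
  F_eq : F = y₁ * y₃ - y₂ ^ 2
  deg_r : natDegree (y₂ * F + y₁ ^ 2) ≤ T
  deg_g : natDegree (y₃ * F ^ 2 + 2 * y₁ * y₂ * F + y₁ ^ 3) + n = T

namespace Growth

variable {n T : ℕ} {y₁ y₂ y₃ F : Polynomial k}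

lemma natDegree_linear (h : Growth n T y₁ y₂ y₃ F) (s q p b : k) :
    let z := Polynomial.C p * y₃ + (Polynomial.C q * y₂ + (Polynomial.C s * y₁ + Polynomial.C b))
    (p ≠ 0 ∧ natDegree z = 3 * T + n) ∨ (p = 0 ∧ q ≠ 0 ∧ natDegree z = 2 * T + n) ∨
      (p = 0 ∧ q = 0 ∧ s ≠ 0 ∧ natDegree z = T + n) ∨ (p = 0 ∧ q = 0 ∧ s = 0) := by
  obtain ⟨n_pos, n_lt, dF, d1, d2, d3, -, -, -⟩ := h
  intro z
  by_cases hp : p = 0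
  · by_cases hq : q = 0
    · by_cases hs : s = 0
      · simp [hp, hq, hs]
      · refine Or.inr (Or.inr (Or.inl ⟨hp, hq, hs, ?_⟩))
        simp only [z, hp, hq, map_zero, zero_mul, zero_add]
        exact natDegree_C_mul_add hs d1 (natDegree_C_lt _ (by omega))
    · refine Or.inr (Or.inl ⟨hp, hq, ?_⟩)
      simp only [z, hp, map_zero, zero_mul, zero_add]
      refine natDegree_C_mul_add hq d2 (natDegree_add_lt (natDegree_C_mul_lt _ ?_)
        (natDegree_C_lt _ ?_)) <;> omega
  · refine Or.inl ⟨hp, ?_⟩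
    refine natDegree_C_mul_add hp d3 (natDegree_add_lt (natDegree_C_mul_lt _ ?_)
      (natDegree_add_lt (natDegree_C_mul_lt _ ?_) (natDegree_C_lt _ ?_))) <;> omega

lemma natDegree_quadratic (h : Growth n T y₁ y₂ y₃ F) (a₃₃ a₂₃ a₂₂ a₁₂ l₃ a₁₁ l₂ l₁ a₀ l₀ : k) :
    let Q := Polynomial.C a₃₃ * y₃ ^ 2 + (Polynomial.C a₂₃ * (y₂ * y₃) +
      (Polynomial.C a₂₂ * y₂ ^ 2 + (Polynomial.C a₁₂ * (y₁ * y₂) + (Polynomial.C l₃ * y₃ +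
      (Polynomial.C a₁₁ * y₁ ^ 2 + (Polynomial.C l₂ * y₂ + (Polynomial.C l₁ * y₁ +
      (Polynomial.C a₀ * F + Polynomial.C l₀))))))))
    (a₃₃ ≠ 0 ∧ natDegree Q = 6 * T + 2 * n) ∨
    (a₃₃ = 0 ∧ a₂₃ ≠ 0 ∧ natDegree Q = 5 * T + 2 * n) ∨
    (a₃₃ = 0 ∧ a₂₃ = 0 ∧ a₂₂ ≠ 0 ∧ natDegree Q = 4 * T + 2 * n) ∨
    (a₃₃ = 0 ∧ a₂₃ = 0 ∧ a₂₂ = 0 ∧ a₁₂ ≠ 0 ∧ natDegree Q = 3 * T + 2 * n) ∨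
    (a₃₃ = 0 ∧ a₂₃ = 0 ∧ a₂₂ = 0 ∧ a₁₂ = 0 ∧ l₃ ≠ 0 ∧ natDegree Q = 3 * T + n) ∨
    (a₃₃ = 0 ∧ a₂₃ = 0 ∧ a₂₂ = 0 ∧ a₁₂ = 0 ∧ l₃ = 0 ∧
      (a₁₁ ≠ 0 ∧ natDegree Q = 2 * T + 2 * n ∨
      a₁₁ = 0 ∧ l₂ ≠ 0 ∧ natDegree Q = 2 * T + n ∨
      a₁₁ = 0 ∧ l₂ = 0 ∧ l₁ ≠ 0 ∧ natDegree Q = T + n ∨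
      a₁₁ = 0 ∧ l₂ = 0 ∧ l₁ = 0 ∧ (a₀ ≠ 0 → natDegree Q = n))) := by
  obtain ⟨n_pos, n_lt, dF, d1, d2, d3, -, -, -⟩ := h
  have e33 : natDegree (y₃ ^ 2) = 6 * T + 2 * n := by rw [natDegree_pow]; omega
  have e22 : natDegree (y₂ ^ 2) = 4 * T + 2 * n := by rw [natDegree_pow]; omega
  have e11 : natDegree (y₁ ^ 2) = 2 * T + 2 * n := by rw [natDegree_pow]; omega
  have e23 : natDegree (y₂ * y₃) = 5 * T + 2 * n := by
    rw [natDegree_mul_pos] <;> omega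
  have e12 : natDegree (y₁ * y₂) = 3 * T + 2 * n := by
    rw [natDegree_mul_pos] <;> omega
  intro Q
  by_cases h33 : a₃₃ = 0; swap
  · refine Or.inl ⟨h33, natDegree_C_mul_add h33 e33 ?_⟩
    (repeat' with_reducible first
      | apply natDegree_add_lt | apply natDegree_C_mul_lt | apply natDegree_C_lt)
      <;> omega
  refine Or.inr ?_
  by_cases h23 : a₂₃ = 0; swap
  · refine Or.inl ⟨h33, h23, ?_⟩
    simp only [Q, h33, map_zero, zero_mul, zero_add]
    refine natDegree_C_mul_add h23 e23 ?_
    (repeat' with_reducible first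
      | apply natDegree_add_lt | apply natDegree_C_mul_lt | apply natDegree_C_lt)
      <;> omega
  refine Or.inr ?_
  by_cases h22 : a₂₂ = 0; swap
  · refine Or.inl ⟨h33, h23, h22, ?_⟩
    simp only [Q, h33, h23, map_zero, zero_mul, zero_add]
    refine natDegree_C_mul_add h22 e22 ?_
    (repeat' with_reducible first
      | apply natDegree_add_lt | apply natDegree_C_mul_lt | apply natDegree_C_lt)
      <;> omega
  refine Or.inr ?_
  by_cases h12 : a₁₂ = 0; swap
  · refine Or.inl ⟨h33, h23, h22, h12, ?_⟩
    simp only [Q, h33, h23, h22, map_zero, zero_mul, zero_add]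
    refine natDegree_C_mul_add h12 e12 ?_
    (repeat' with_reducible first
      | apply natDegree_add_lt | apply natDegree_C_mul_lt | apply natDegree_C_lt)
      <;> omega
  refine Or.inr ?_
  by_cases h3 : l₃ = 0; swap
  · refine Or.inl ⟨h33, h23, h22, h12, h3, ?_⟩
    simp only [Q, h33, h23, h22, h12, map_zero, zero_mul, zero_add]
    refine natDegree_C_mul_add h3 d3 ?_
    (repeat' with_reducible first
      | apply natDegree_add_lt | apply natDegree_C_mul_lt | apply natDegree_C_lt)
      <;> omega
  refine Or.inr ⟨h33, h23, h22, h12, h3, ?_⟩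
  by_cases h11 : a₁₁ = 0; swap
  · refine Or.inl ⟨h11, ?_⟩
    simp only [Q, h33, h23, h22, h12, h3, map_zero, zero_mul, zero_add]
    refine natDegree_C_mul_add h11 e11 ?_
    (repeat' with_reducible first
      | apply natDegree_add_lt | apply natDegree_C_mul_lt | apply natDegree_C_lt)
      <;> omega
  refine Or.inr ?_
  by_cases h2 : l₂ = 0; swap
  · refine Or.inl ⟨h11, h2, ?_⟩
    simp only [Q, h33, h23, h22, h12, h3, h11, map_zero, zero_mul, zero_add]
    refine natDegree_C_mul_add h2 d2 ?_
    (repeat' with_reducible first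
      | apply natDegree_add_lt | apply natDegree_C_mul_lt | apply natDegree_C_lt)
      <;> omega
  refine Or.inr ?_
  by_cases h1 : l₁ = 0; swap
  · refine Or.inl ⟨h11, h2, h1, ?_⟩
    simp only [Q, h33, h23, h22, h12, h3, h11, h2, map_zero, zero_mul, zero_add]
    refine natDegree_C_mul_add h1 d1 ?_
    (repeat' with_reducible first
      | apply natDegree_add_lt | apply natDegree_C_mul_lt | apply natDegree_C_lt)
      <;> omega
  refine Or.inr ⟨h11, h2, h1, fun h0 => ?_⟩
  simp only [Q, h33, h23, h22, h12, h3, h11, h2, h1, map_zero, zero_mul, zero_add]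
  exact natDegree_C_mul_add h0 dF (natDegree_C_lt _ n_pos)

end Growth

/-- The degree conditions which are propagated by `exp (uΔ)` followed by an affine
automorphism outside the torus. -/
structure Dominated (z₁ z₂ z₃ f r g : Polynomial k) : Prop where
  f_pos : 0 < natDegree f
  r_lt : natDegree r < natDegree g
  one_lt : natDegree z₁ < natDegree g
  two_lt : natDegree z₂ < 2 * natDegree g
  three_lt : natDegree z₃ < 3 * natDegree g

lemma natDegree_r_le {z₁ z₂ f : Polynomial k} :
    natDegree (z₂ * f + z₁ ^ 2) ≤ max (natDegree z₂ + natDegree f) (2 * natDegree z₁) := by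
  refine (Polynomial.natDegree_add_le _ _).trans (max_le_max ?_ ?_)
  · exact Polynomial.natDegree_mul_le
  · exact Polynomial.natDegree_pow_le

lemma natDegree_g_eq_left {z₁ z₂ z₃ f : Polynomial k} (hz : 0 < natDegree z₃)
    (hf : 0 < natDegree f) (h₁ : natDegree z₁ + natDegree z₂ < natDegree z₃ + natDegree f)
    (h₂ : 3 * natDegree z₁ < natDegree z₃ + 2 * natDegree f) :
    natDegree (z₃ * f ^ 2 + 2 * z₁ * z₂ * f + z₁ ^ 3) = natDegree z₃ + 2 * natDegree f := by
  have e : natDegree (z₃ * f ^ 2) = natDegree z₃ + 2 * natDegree f := by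
    rw [natDegree_mul_pos hz (by rw [natDegree_pow]; omega), natDegree_pow]
  have : z₃ * f ^ 2 + 2 * z₁ * z₂ * f + z₁ ^ 3 =
      z₃ * f ^ 2 + (Polynomial.C 2 * (z₁ * z₂ * f) + z₁ ^ 3) := by
    simp only [map_ofNat]; ring
  rw [this, natDegree_add_eq_left_of_natDegree_lt, e]
  rw [e]
  refine natDegree_add_lt (natDegree_C_mul_lt _ ?_) ?_
  · exact (natDegree_mul_le_of_le (Polynomial.natDegree_mul_le) le_rfl).trans_lt (by omega)
  · rw [natDegree_pow]; omega

lemma natDegree_g_eq_right {z₁ z₂ z₃ f : Polynomial k}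
    (h₁ : natDegree z₂ + natDegree f < 2 * natDegree z₁)
    (h₂ : natDegree z₃ + 2 * natDegree f < 3 * natDegree z₁) :
    natDegree (z₃ * f ^ 2 + 2 * z₁ * z₂ * f + z₁ ^ 3) = 3 * natDegree z₁ := by
  have : z₃ * f ^ 2 + 2 * z₁ * z₂ * f + z₁ ^ 3 =
      z₁ ^ 3 + (Polynomial.C 2 * (z₁ * z₂ * f) + z₃ * f ^ 2) := by
    simp only [map_ofNat]; ring
  rw [this, natDegree_add_eq_left_of_natDegree_lt, natDegree_pow]
  rw [natDegree_pow]
  refine natDegree_add_lt (natDegree_C_mul_lt _ ?_) ?_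
  · exact (natDegree_mul_le_of_le (Polynomial.natDegree_mul_le) le_rfl).trans_lt (by omega)
  · exact (natDegree_mul_le_of_le le_rfl (natDegree_pow_le_of_le _ le_rfl)).trans_lt (by omega)

lemma Dominated.of_left {z₁ z₂ z₃ f : Polynomial k} (hz : 0 < natDegree z₃)
    (hf : 0 < natDegree f) (h₁ : natDegree z₁ + natDegree z₂ < natDegree z₃ + natDegree f)
    (h₂ : 3 * natDegree z₁ < natDegree z₃ + 2 * natDegree f) :
    Dominated z₁ z₂ z₃ f (z₂ * f + z₁ ^ 2) (z₃ * f ^ 2 + 2 * z₁ * z₂ * f + z₁ ^ 3) := by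
  have hg := natDegree_g_eq_left hz hf h₁ h₂
  have hr := natDegree_r_le (z₁ := z₁) (z₂ := z₂) (f := f)
  constructor <;> omega

lemma Dominated.of_right {z₁ z₂ z₃ f : Polynomial k} (hz : 0 < natDegree z₁)
    (hf : 0 < natDegree f) (h₁ : natDegree z₂ + natDegree f < 2 * natDegree z₁)
    (h₂ : natDegree z₃ + 2 * natDegree f < 3 * natDegree z₁) :
    Dominated z₁ z₂ z₃ f (z₂ * f + z₁ ^ 2) (z₃ * f ^ 2 + 2 * z₁ * z₂ * f + z₁ ^ 3) := by
  have hg := natDegree_g_eq_right h₁ h₂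
  have hr := natDegree_r_le (z₁ := z₁) (z₂ := z₂) (f := f)
  constructor <;> omega

namespace Growth

variable {n T : ℕ} {y₁ y₂ y₃ F : Polynomial k}

/-- Triangular affine maps which scale `f`, but not compatibly with `g`. -/
lemma dominated_of_cube_ne_sq (h : Growth n T y₁ y₂ y₃ F) {s₁ q₂ s₂ p₃ q₃ s₃ : k}
    (hs₁ : s₁ ≠ 0) (hq₂ : q₂ ≠ 0) (hp₃ : p₃ ≠ 0) (hc : s₁ * p₃ = q₂ ^ 2) (hne : q₂ ^ 3 ≠ s₁ ^ 2)
    {z₁ z₂ z₃ f : Polynomial k} (hz₁ : z₁ = Polynomial.C s₁ * y₁)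
    (hz₂ : z₂ = Polynomial.C q₂ * y₂ + Polynomial.C s₂ * y₁)
    (hz₃ : z₃ = Polynomial.C p₃ * y₃ + (Polynomial.C q₃ * y₂ + Polynomial.C s₃ * y₁))
    (hf : f = Polynomial.C (q₂ ^ 2) * F) :
    Dominated z₁ z₂ z₃ f (z₂ * f + z₁ ^ 2) (z₃ * f ^ 2 + 2 * z₁ * z₂ * f + z₁ ^ 3) := by
  obtain ⟨n_pos, n_lt, dF, d1, d2, d3, -, dr, dg⟩ := h
  have hg : z₃ * f ^ 2 + 2 * z₁ * z₂ * f + z₁ ^ 3 =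
      Polynomial.C (p₃ * q₂ ^ 4 - 2 * s₁ * q₂ ^ 3 + s₁ ^ 3) * y₁ ^ 3 +
      (Polynomial.C (p₃ * q₂ ^ 4) * (y₃ * F ^ 2 + 2 * y₁ * y₂ * F + y₁ ^ 3) +
      (Polynomial.C (2 * s₁ * q₂ ^ 3 - 2 * p₃ * q₂ ^ 4) * (y₁ * (y₂ * F + y₁ ^ 2)) +
      (Polynomial.C (q₃ * q₂ ^ 4) * (F * (y₂ * F + y₁ ^ 2)) +
      (Polynomial.C (2 * s₁ * s₂ * q₂ ^ 2 - q₃ * q₂ ^ 4) * (F * y₁ ^ 2) +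
      Polynomial.C (s₃ * q₂ ^ 4) * (y₁ * F ^ 2))))) := by
    subst hz₁ hz₂ hz₃ hf
    simp only [map_add, map_sub, map_mul, map_pow, map_ofNat]
    ring
  have hcoef : p₃ * q₂ ^ 4 - 2 * s₁ * q₂ ^ 3 + s₁ ^ 3 ≠ 0 := by
    intro h0
    refine hne (sub_eq_zero.1 (pow_eq_zero_iff two_ne_zero |>.1 ?_))
    linear_combination s₁ * h0 - q₂ ^ 4 * hc
  have dg' : natDegree (z₃ * f ^ 2 + 2 * z₁ * z₂ * f + z₁ ^ 3) = 3 * T + 3 * n := by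
    rw [hg]
    refine natDegree_C_mul_add hcoef (by rw [natDegree_pow, d1]; ring) ?_
    refine natDegree_add_lt (natDegree_C_mul_lt _ (by omega)) (natDegree_add_lt
      (natDegree_C_mul_lt _ ?_) (natDegree_add_lt (natDegree_C_mul_lt _ ?_) (natDegree_add_lt
      (natDegree_C_mul_lt _ ?_) (natDegree_C_mul_lt _ ?_))))
    · exact (natDegree_mul_le_of_le d1.le dr).trans_lt (by omega)
    · exact (natDegree_mul_le_of_le dF.le dr).trans_lt (by omega)
    · exact (natDegree_mul_le_of_le dF.le (natDegree_pow_le_of_le 2 d1.le)).trans_lt (by omega)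
    · exact (natDegree_mul_le_of_le d1.le (natDegree_pow_le_of_le 2 dF.le)).trans_lt (by omega)
  have df : natDegree f = n := by rw [hf, natDegree_C_mul (pow_ne_zero _ hq₂), dF]
  have dz₁ : natDegree z₁ = T + n := by rw [hz₁, natDegree_C_mul hs₁, d1]
  have dz₂ : natDegree z₂ = 2 * T + n := by
    rw [hz₂]; exact natDegree_C_mul_add hq₂ d2 (natDegree_C_mul_lt _ (by omega))
  have dz₃ : natDegree z₃ = 3 * T + n := by
    rw [hz₃]
    exact natDegree_C_mul_add hp₃ d3 (natDegree_add_lt (natDegree_C_mul_lt _ (by omega))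
      (natDegree_C_mul_lt _ (by omega)))
  have hr := natDegree_r_le (z₁ := z₁) (z₂ := z₂) (f := f)
  constructor <;> omega

/-- Triangular affine maps which are compatible with both `f` and `g` on the diagonal. -/
lemma dominated_of_unipotent (h : Growth n T y₁ y₂ y₃ F) {w e : k} (hw : w ≠ 0) (he : e ≠ 0)
    {z₁ z₂ z₃ f : Polynomial k} (hz₁ : z₁ = Polynomial.C (w ^ 3) * y₁)
    (hz₂ : z₂ = Polynomial.C (w ^ 2) * y₂ + Polynomial.C (e * w ^ 3) * y₁)
    (hz₃ : z₃ = Polynomial.C w * y₃ +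
      (Polynomial.C (2 * e * w ^ 2) * y₂ + Polynomial.C (e ^ 2 * w ^ 3) * y₁))
    (hf : f = Polynomial.C (w ^ 4) * F) :
    Dominated z₁ z₂ z₃ f (z₂ * f + z₁ ^ 2) (z₃ * f ^ 2 + 2 * z₁ * z₂ * f + z₁ ^ 3) := by
  obtain ⟨n_pos, n_lt, dF, d1, d2, d3, -, dr, dg⟩ := h
  have hg : z₃ * f ^ 2 + 2 * z₁ * z₂ * f + z₁ ^ 3 =
      Polynomial.C (e ^ 2 * w ^ 11) * (y₁ * F ^ 2) +
      (Polynomial.C (w ^ 9) * (y₃ * F ^ 2 + 2 * y₁ * y₂ * F + y₁ ^ 3) +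
      Polynomial.C (2 * e * w ^ 10) * (F * (y₂ * F + y₁ ^ 2))) := by
    subst hz₁ hz₂ hz₃ hf
    simp only [map_mul, map_pow, map_ofNat]
    ring
  have hr : z₂ * f + z₁ ^ 2 = Polynomial.C (w ^ 6) * (y₂ * F + y₁ ^ 2) +
      Polynomial.C (e * w ^ 7) * (y₁ * F) := by
    subst hz₁ hz₂ hz₃ hf
    simp only [map_mul, map_pow]
    ring
  have dg' : natDegree (z₃ * f ^ 2 + 2 * z₁ * z₂ * f + z₁ ^ 3) = T + 3 * n := by
    rw [hg]
    refine natDegree_C_mul_add (mul_ne_zero (pow_ne_zero _ he) (pow_ne_zero _ hw)) ?_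
      (natDegree_add_lt (natDegree_C_mul_lt _ (by omega)) (natDegree_C_mul_lt _ ?_))
    · rw [natDegree_mul_pos (by omega) (by rw [natDegree_pow]; omega), natDegree_pow]; omega
    · exact (natDegree_mul_le_of_le dF.le dr).trans_lt (by omega)
  have dr' : natDegree (z₂ * f + z₁ ^ 2) < T + 3 * n := by
    rw [hr]
    refine natDegree_add_lt (natDegree_C_mul_lt _ (by omega)) (natDegree_C_mul_lt _ ?_)
    exact (natDegree_mul_le_of_le d1.le dF.le).trans_lt (by omega)
  have df : natDegree f = n := by rw [hf, natDegree_C_mul (pow_ne_zero _ hw), dF]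
  have dz₁ : natDegree z₁ = T + n := by rw [hz₁, natDegree_C_mul (pow_ne_zero _ hw), d1]
  have dz₂ : natDegree z₂ = 2 * T + n := by
    rw [hz₂]; exact natDegree_C_mul_add (pow_ne_zero _ hw) d2 (natDegree_C_mul_lt _ (by omega))
  have dz₃ : natDegree z₃ = 3 * T + n := by
    rw [hz₃]
    exact natDegree_C_mul_add hw d3 (natDegree_add_lt (natDegree_C_mul_lt _ (by omega))
      (natDegree_C_mul_lt _ (by omega)))
  constructor <;> omega

/-- The degree of the image of `r` is not the critical one when `f` becomes linear in `y₃`. -/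
lemma natDegree_r_dichotomy (h : Growth n T y₁ y₂ y₃ F) {p₁ q₁ p₂ q₂ l₃ l₂ a₁₁ : k}
    (hp₂ : p₂ ≠ 0) {v₁ v₂ v : Polynomial k} (hv₁ : natDegree v₁ ≤ T + n)
    (hv₂ : natDegree v₂ ≤ T + n) (hv : natDegree v ≤ T + n) {z₁ z₂ f : Polynomial k}
    (hz₁ : z₁ = Polynomial.C p₁ * y₃ + (Polynomial.C q₁ * y₂ + v₁))
    (hz₂ : z₂ = Polynomial.C p₂ * y₃ + (Polynomial.C q₂ * y₂ + v₂))
    (hf : f = Polynomial.C l₃ * y₃ + (Polynomial.C a₁₁ * y₁ ^ 2 + (Polynomial.C l₂ * y₂ + v))) :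
    5 * T + 2 * n ≤ natDegree (z₂ * f + z₁ ^ 2) ∨ natDegree (z₂ * f + z₁ ^ 2) ≤ 4 * T + 2 * n := by
  obtain ⟨n_pos, n_lt, dF, d1, d2, d3, -, -, -⟩ := h
  have b1 := d1.le
  have b2 := d2.le
  have b3 := d3.le
  have hr : z₂ * f + z₁ ^ 2 = Polynomial.C (p₂ * l₃ + p₁ ^ 2) * y₃ ^ 2 +
      (Polynomial.C (p₂ * a₁₁) * (y₃ * y₁ ^ 2) +
      (Polynomial.C (p₂ * l₂ + q₂ * l₃ + 2 * p₁ * q₁) * (y₂ * y₃) +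
      (Polynomial.C (q₂ * a₁₁) * (y₂ * y₁ ^ 2) + (Polynomial.C a₁₁ * (v₂ * y₁ ^ 2) +
      (Polynomial.C p₂ * (y₃ * v) + (Polynomial.C l₃ * (y₃ * v₂) +
      (Polynomial.C (2 * p₁) * (y₃ * v₁) + (Polynomial.C (q₂ * l₂ + q₁ ^ 2) * y₂ ^ 2 +
      (Polynomial.C q₂ * (y₂ * v) + (Polynomial.C l₂ * (y₂ * v₂) +
      (Polynomial.C (2 * q₁) * (y₂ * v₁) + (v₂ * v + v₁ ^ 2)))))))))))) := by
    subst hz₁ hz₂ hf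
    simp only [map_add, map_mul, map_pow, map_ofNat]
    ring
  rw [hr]
  by_cases he : p₂ * l₃ + p₁ ^ 2 = 0; swap
  · left
    rw [natDegree_C_mul_add he (N := 6 * T + 2 * n) (by rw [natDegree_pow]; omega)]
    · omega
    (repeat' with_reducible first
      | apply natDegree_add_lt | apply natDegree_C_mul_lt | apply natDegree_C_lt)
    all_goals
      apply lt_of_le_of_lt
      · (repeat' with_reducible first
          | assumption | apply natDegree_mul_le_of_le | apply natDegree_pow_le_of_le)
      · omega
  by_cases ha : a₁₁ = 0; swap
  · left
    rw [he, map_zero, zero_mul, zero_add, natDegree_C_mul_add (mul_ne_zero hp₂ ha)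
      (N := 5 * T + 3 * n) (by
        rw [natDegree_mul_pos (by omega) (by rw [natDegree_pow]; omega), natDegree_pow]; omega)]
    · omega
    (repeat' with_reducible first
      | apply natDegree_add_lt | apply natDegree_C_mul_lt | apply natDegree_C_lt)
    all_goals
      apply lt_of_le_of_lt
      · (repeat' with_reducible first
          | assumption | apply natDegree_mul_le_of_le | apply natDegree_pow_le_of_le)
      · omega
  simp only [he, ha, mul_zero, map_zero, zero_mul, zero_add]
  by_cases he' : p₂ * l₂ + q₂ * l₃ + 2 * p₁ * q₁ = 0
  · right
    rw [he', map_zero, zero_mul, zero_add, ← Nat.lt_succ_iff]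
    (repeat' with_reducible first
      | apply natDegree_add_lt | apply natDegree_C_mul_lt | apply natDegree_C_lt)
    all_goals
      apply lt_of_le_of_lt
      · (repeat' with_reducible first
          | assumption | apply natDegree_mul_le_of_le | apply natDegree_pow_le_of_le)
      · omega
  · left
    rw [natDegree_C_mul_add he' (N := 5 * T + 2 * n) (by
        rw [natDegree_mul_pos (by omega) (by omega)]; omega)]
    (repeat' with_reducible first
      | apply natDegree_add_lt | apply natDegree_C_mul_lt | apply natDegree_C_lt)
    all_goals
      apply lt_of_le_of_lt
      · (repeat' with_reducible first
          | assumption | apply natDegree_mul_le_of_le | apply natDegree_pow_le_of_le)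
      · omega

/-- When the images of `x₁, x₂, x₃, f` all have the same degree, the degree of the image of `g`
is read off from `x₁ g = r² + f³`. -/
lemma dominated_of_dichotomy {z₁ z₂ z₃ f : Polynomial k} (hn : n < T)
    (hz₁ : natDegree z₁ = 3 * T + n) (hz₂ : natDegree z₂ = 3 * T + n)
    (hz₃ : natDegree z₃ = 3 * T + n) (df : natDegree f = 3 * T + n) (hf : f = z₁ * z₃ - z₂ ^ 2)
    (hr : 5 * T + 2 * n ≤ natDegree (z₂ * f + z₁ ^ 2) ∨
      natDegree (z₂ * f + z₁ ^ 2) ≤ 4 * T + 2 * n) :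
    Dominated z₁ z₂ z₃ f (z₂ * f + z₁ ^ 2) (z₃ * f ^ 2 + 2 * z₁ * z₂ * f + z₁ ^ 3) := by
  have key : z₁ * (z₃ * f ^ 2 + 2 * z₁ * z₂ * f + z₁ ^ 3) = (z₂ * f + z₁ ^ 2) ^ 2 + f ^ 3 := by
    linear_combination -f ^ 2 * hf
  generalize z₂ * f + z₁ ^ 2 = r at *
  generalize z₃ * f ^ 2 + 2 * z₁ * z₂ * f + z₁ ^ 3 = g at *
  have hmax : natDegree (z₁ * g) = max (2 * natDegree r) (3 * natDegree f) := by
    rw [key]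
    rcases hr with hr | hr
    · rw [natDegree_add_eq_left_of_natDegree_lt] <;> simp only [natDegree_pow] <;> omega
    · rw [Polynomial.natDegree_add_eq_right_of_natDegree_lt] <;> simp only [natDegree_pow] <;> omega
  have hg : g ≠ 0 := by
    rintro rfl
    rw [mul_zero, Polynomial.natDegree_zero] at hmax
    omega
  rw [natDegree_mul (ne_zero_of_natDegree_gt (n := 0) (by omega)) hg] at hmax
  constructor <;> omega

end Growth

namespace Growth

variable {n T : ℕ} {y₁ y₂ y₃ F : Polynomial k}

/-- An affine map preserving the degree of `f` either lies in the torus or makes the image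
of `g` dominant. -/
lemma dominated_of_triangular (h : Growth n T y₁ y₂ y₃ F) {s₁ q₂ s₂ p₃ q₃ s₃ : k}
    (hs₁ : s₁ ≠ 0) (hq₂ : q₂ ≠ 0) (hp₃ : p₃ ≠ 0) (hc : s₁ * p₃ = q₂ ^ 2)
    (h12 : s₁ * q₃ = 2 * s₂ * q₂) (h11 : s₁ * s₃ = s₂ ^ 2)
    {z₁ z₂ z₃ f : Polynomial k} (hz₁ : z₁ = Polynomial.C s₁ * y₁)
    (hz₂ : z₂ = Polynomial.C q₂ * y₂ + Polynomial.C s₂ * y₁)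
    (hz₃ : z₃ = Polynomial.C p₃ * y₃ + (Polynomial.C q₃ * y₂ + Polynomial.C s₃ * y₁))
    (hf : f = Polynomial.C (q₂ ^ 2) * F) :
    (∃ w, w ≠ 0 ∧ s₁ = w ^ 3 ∧ s₂ = 0 ∧ q₂ = w ^ 2 ∧ s₃ = 0 ∧ q₃ = 0 ∧ p₃ = w) ∨
    Dominated z₁ z₂ z₃ f (z₂ * f + z₁ ^ 2) (z₃ * f ^ 2 + 2 * z₁ * z₂ * f + z₁ ^ 3) := by
  by_cases hne : q₂ ^ 3 = s₁ ^ 2; swap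
  · exact Or.inr (h.dominated_of_cube_ne_sq hs₁ hq₂ hp₃ hc hne hz₁ hz₂ hz₃ hf)
  have hw : p₃ ^ 2 = q₂ := by
    apply mul_left_cancel₀ (pow_ne_zero 3 hq₂)
    linear_combination p₃ ^ 2 * hne + (s₁ * p₃ + q₂ ^ 2) * hc
  have hw3 : p₃ ^ 3 = s₁ := by
    apply mul_left_cancel₀ hp₃
    rw [mul_comm p₃ s₁, hc, ← hw]; ring
  subst hw3
  obtain rfl := hw
  by_cases he : s₂ = 0
  · subst he
    exact Or.inl ⟨p₃, hp₃, rfl, rfl, rfl, by simpa [hp₃] using h11, by simpa [hp₃] using h12, rfl⟩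
  · refine Or.inr ?_
    have e2 : s₂ / p₃ ^ 3 * p₃ ^ 3 = s₂ := by field_simp
    have e3 : s₃ = (s₂ / p₃ ^ 3) ^ 2 * p₃ ^ 3 := by
      apply mul_left_cancel₀ hs₁
      rw [h11]; field_simp
    have e1 : q₃ = 2 * (s₂ / p₃ ^ 3) * p₃ ^ 2 := by
      apply mul_left_cancel₀ hs₁
      rw [h12]; field_simp
    refine h.dominated_of_unipotent hp₃ (div_ne_zero he hs₁) hz₁ ?_ ?_ ?_
    · rw [hz₂, e2]
    · rw [hz₃, ← e3, ← e1]
    · rw [hf, ← pow_mul]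

/-- The induction step: an affine automorphism which is not in the torus turns the growth
produced by `exp (uΔ)` back into the degree conditions `Dominated`. -/
theorem torus_or_dominated [CharZero k] (h : Growth n T y₁ y₂ y₃ F)
    {s₁ q₁ p₁ b₁ s₂ q₂ p₂ b₂ s₃ q₃ p₃ b₃ : k}
    (hdet : s₁ * (q₂ * p₃ - q₃ * p₂) - s₂ * (q₁ * p₃ - q₃ * p₁) + s₃ * (q₁ * p₂ - q₂ * p₁) ≠ 0)
    {z₁ z₂ z₃ f : Polynomial k}
    (hz₁ : z₁ = Polynomial.C p₁ * y₃ + (Polynomial.C q₁ * y₂ +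
      (Polynomial.C s₁ * y₁ + Polynomial.C b₁)))
    (hz₂ : z₂ = Polynomial.C p₂ * y₃ + (Polynomial.C q₂ * y₂ +
      (Polynomial.C s₂ * y₁ + Polynomial.C b₂)))
    (hz₃ : z₃ = Polynomial.C p₃ * y₃ + (Polynomial.C q₃ * y₂ +
      (Polynomial.C s₃ * y₁ + Polynomial.C b₃)))
    (hf : f = z₁ * z₃ - z₂ ^ 2) :
    (∃ w, w ≠ 0 ∧ (s₁ = w ^ 3 ∧ q₁ = 0 ∧ p₁ = 0 ∧ b₁ = 0) ∧
      (s₂ = 0 ∧ q₂ = w ^ 2 ∧ p₂ = 0 ∧ b₂ = 0) ∧ (s₃ = 0 ∧ q₃ = 0 ∧ p₃ = w ∧ b₃ = 0)) ∨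
    Dominated z₁ z₂ z₃ f (z₂ * f + z₁ ^ 2) (z₃ * f ^ 2 + 2 * z₁ * z₂ * f + z₁ ^ 3) := by
  have L1 := h.natDegree_linear s₁ q₁ p₁ b₁
  have L2 := h.natDegree_linear s₂ q₂ p₂ b₂
  have L3 := h.natDegree_linear s₃ q₃ p₃ b₃
  have LQ := h.natDegree_quadratic (p₁ * p₃ - p₂ ^ 2) (p₁ * q₃ + p₃ * q₁ - 2 * p₂ * q₂)
    (q₁ * q₃ - q₂ ^ 2 + (s₁ * p₃ + s₃ * p₁ - 2 * s₂ * p₂)) (s₁ * q₃ + s₃ * q₁ - 2 * s₂ * q₂)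
    (b₁ * p₃ + b₃ * p₁ - 2 * b₂ * p₂) (s₁ * s₃ - s₂ ^ 2) (b₁ * q₃ + b₃ * q₁ - 2 * b₂ * q₂)
    (b₁ * s₃ + b₃ * s₁ - 2 * b₂ * s₂) (s₁ * p₃ + s₃ * p₁ - 2 * s₂ * p₂) (b₁ * b₃ - b₂ ^ 2)
  have hQ : f = Polynomial.C (p₁ * p₃ - p₂ ^ 2) * y₃ ^ 2 +
      (Polynomial.C (p₁ * q₃ + p₃ * q₁ - 2 * p₂ * q₂) * (y₂ * y₃) +
      (Polynomial.C (q₁ * q₃ - q₂ ^ 2 + (s₁ * p₃ + s₃ * p₁ - 2 * s₂ * p₂)) * y₂ ^ 2 +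
      (Polynomial.C (s₁ * q₃ + s₃ * q₁ - 2 * s₂ * q₂) * (y₁ * y₂) +
      (Polynomial.C (b₁ * p₃ + b₃ * p₁ - 2 * b₂ * p₂) * y₃ +
      (Polynomial.C (s₁ * s₃ - s₂ ^ 2) * y₁ ^ 2 +
      (Polynomial.C (b₁ * q₃ + b₃ * q₁ - 2 * b₂ * q₂) * y₂ +
      (Polynomial.C (b₁ * s₃ + b₃ * s₁ - 2 * b₂ * s₂) * y₁ +
      (Polynomial.C (s₁ * p₃ + s₃ * p₁ - 2 * s₂ * p₂) * F +
      Polynomial.C (b₁ * b₃ - b₂ ^ 2))))))))) := by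
    rw [hf, hz₁, hz₂, hz₃]
    simp only [map_add, map_sub, map_mul, map_pow, map_ofNat]
    linear_combination (- (Polynomial.C s₁ * Polynomial.C p₃ + Polynomial.C s₃ * Polynomial.C p₁ -
      2 * Polynomial.C s₂ * Polynomial.C p₂)) * h.F_eq
  simp only [← hz₁, ← hz₂, ← hz₃, ← hQ] at L1 L2 L3 LQ
  have n_pos := h.n_pos
  have n_lt := h.n_lt
  by_cases hlow : p₁ * p₃ - p₂ ^ 2 = 0 ∧ p₁ * q₃ + p₃ * q₁ - 2 * p₂ * q₂ = 0; swap
  · right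
    have d3 : T + n ≤ natDegree z₃ := by
      rcases L3 with ⟨-, d3⟩ | ⟨-, -, d3⟩ | ⟨-, -, -, d3⟩ | ⟨rfl, rfl, rfl⟩
      · omega
      · omega
      · omega
      · exact absurd (by ring) hdet
    have d1 : natDegree z₁ ≤ 3 * T + n := by
      rcases L1 with ⟨-, d3⟩ | ⟨-, -, d3⟩ | ⟨-, -, -, d3⟩ | ⟨rfl, rfl, rfl⟩
      · omega
      · omega
      · omega
      · simp [hz₁]
    have d2 : natDegree z₂ ≤ 3 * T + n := by
      rcases L2 with ⟨-, d3⟩ | ⟨-, -, d3⟩ | ⟨-, -, -, d3⟩ | ⟨rfl, rfl, rfl⟩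
      · omega
      · omega
      · omega
      · simp [hz₂]
    have hE : 5 * T + 2 * n ≤ natDegree f := by
      rcases LQ with ⟨-, e⟩ | ⟨-, -, e⟩ | ⟨h1, h2, -⟩ | ⟨h1, h2, -⟩ | ⟨h1, h2, -⟩ | ⟨h1, h2, -⟩
      · omega
      · omega
      all_goals exact absurd ⟨h1, h2⟩ hlow
    exact Dominated.of_left (by omega) (by omega) (by omega) (by omega)
  obtain ⟨h33, h23⟩ := hlow
  have h13 : s₁ * p₃ + s₃ * p₁ - 2 * s₂ * p₂ ≠ 0 := by
    intro h0
    apply hdet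
    have : 2 * (s₁ * (q₂ * p₃ - q₃ * p₂) - s₂ * (q₁ * p₃ - q₃ * p₁) +
        s₃ * (q₁ * p₂ - q₂ * p₁)) ^ 2 = 0 := by
      linear_combination (8 * (s₁ * s₃ - s₂ ^ 2) * (q₁ * q₃ - q₂ ^ 2) -
        2 * (s₁ * q₃ + s₃ * q₁ - 2 * s₂ * q₂) ^ 2) * h33 +
        ((s₁ * q₃ + s₃ * q₁ - 2 * s₂ * q₂) * (s₁ * p₃ + s₃ * p₁ - 2 * s₂ * p₂) -
        2 * (s₁ * s₃ - s₂ ^ 2) * (p₁ * q₃ + p₃ * q₁ - 2 * p₂ * q₂)) * h23 +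
        ((s₁ * q₃ + s₃ * q₁ - 2 * s₂ * q₂) * (p₁ * q₃ + p₃ * q₁ - 2 * p₂ * q₂) -
        2 * (q₁ * q₃ - q₂ ^ 2) * (s₁ * p₃ + s₃ * p₁ - 2 * s₂ * p₂)) * h0
    simpa using this
  by_cases hp₁ : p₁ = 0
  · subst hp₁
    have hp₂ : p₂ = 0 := by simpa using h33
    subst hp₂
    have hp₃ : p₃ ≠ 0 := by rintro rfl; simp at h13
    have hs₁ : s₁ ≠ 0 := by rintro rfl; simp at h13
    have hq₁ : q₁ = 0 := by simpa [hp₃] using h23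
    subst hq₁
    have hq₂ : q₂ ≠ 0 := by rintro rfl; simp at hdet
    have d1 : natDegree z₁ = T + n := by simpa [hs₁] using L1
    have d2 : natDegree z₂ = 2 * T + n := by simpa [hq₂] using L2
    have d3 : natDegree z₃ = 3 * T + n := by simpa [hp₃] using L3
    by_cases hE : n < natDegree f
    · exact Or.inr (Dominated.of_left (by omega) (by omega) (by omega) (by omega))
    rcases LQ with ⟨-, e⟩ | ⟨-, -, e⟩ | ⟨-, -, -, e⟩ | ⟨-, -, -, -, e⟩ | ⟨-, -, -, -, -, e⟩ |
      ⟨-, -, h22, h12, h3, ⟨-, e⟩ | ⟨-, -, e⟩ | ⟨-, -, -, e⟩ | ⟨h11, h2, h1, -⟩⟩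
    any_goals omega
    have hb₁ : b₁ = 0 := by simpa [hp₃] using h3
    subst hb₁
    have hb₂ : b₂ = 0 := by simpa [hq₂] using h2
    subst hb₂
    have hb₃ : b₃ = 0 := by simpa [hs₁] using h1
    subst hb₃
    have hc : s₁ * p₃ = q₂ ^ 2 := by linear_combination h22
    refine (h.dominated_of_triangular (s₁ := s₁) (q₂ := q₂) (s₂ := s₂) (p₃ := p₃) (q₃ := q₃)
      (s₃ := s₃) hs₁ hq₂ hp₃ hc (by linear_combination h12) (by linear_combination h11)
      (by simpa using hz₁) (by simpa using hz₂) (by simpa using hz₃) ?_).imp_left ?_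
    · rw [hQ, ← hc]
      simp only [h33, h23, h12, h3, h11, h2, h1]
      simp
    · rintro ⟨w, hw, rfl, rfl, rfl, rfl, rfl, rfl⟩
      exact ⟨_, hw, ⟨rfl, rfl, rfl, rfl⟩, ⟨rfl, rfl, rfl, rfl⟩, rfl, rfl, rfl, rfl⟩
  right
  have d1 : natDegree z₁ = 3 * T + n := by simpa [hp₁] using L1
  have hE : 0 < natDegree f ∧ (natDegree f ≤ 3 * T + 2 * n ∨ natDegree f = 4 * T + 2 * n) := by
    rcases LQ with ⟨h, -⟩ | ⟨-, h, -⟩ | ⟨-, -, -, e⟩ | ⟨-, -, -, -, e⟩ | ⟨-, -, -, -, -, e⟩ |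
      ⟨-, -, -, -, -, ⟨-, e⟩ | ⟨-, -, e⟩ | ⟨-, -, -, e⟩ | ⟨-, -, -, e⟩⟩
    · exact absurd h33 h
    · exact absurd h23 h
    any_goals omega
    have := e h13
    omega
  by_cases hp₂ : p₂ = 0
  · subst hp₂
    have hp₃ : p₃ = 0 := by simpa [hp₁] using h33
    subst hp₃
    have hq₃ : q₃ = 0 := by simpa [hp₁] using h23
    subst hq₃
    have hq₂ : q₂ ≠ 0 := by rintro rfl; simp at hdet
    have hs₃ : s₃ ≠ 0 := by rintro rfl; simp at hdet
    have d2 : natDegree z₂ = 2 * T + n := by simpa [hq₂] using L2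
    have d3 : natDegree z₃ = T + n := by simpa [hs₃] using L3
    by_cases hE' : natDegree f = 4 * T + 2 * n
    · exact Dominated.of_left (by omega) (by omega) (by omega) (by omega)
    · exact Dominated.of_right (by omega) (by omega) (by omega) (by omega)
  have hp₃ : p₃ ≠ 0 := by rintro rfl; simp [hp₂] at h33
  have d2 : natDegree z₂ = 3 * T + n := by simpa [hp₂] using L2
  have d3 : natDegree z₃ = 3 * T + n := by simpa [hp₃] using L3
  rcases lt_trichotomy (natDegree f) (3 * T + n) with hE' | hE' | hE'
  · exact Dominated.of_right (by omega) (by omega) (by omega) (by omega)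
  · refine dominated_of_dichotomy n_lt d1 d2 d3 hE' hf ?_
    have hzero : q₁ * q₃ - q₂ ^ 2 + (s₁ * p₃ + s₃ * p₁ - 2 * s₂ * p₂) = 0 ∧
        s₁ * q₃ + s₃ * q₁ - 2 * s₂ * q₂ = 0 := by
      rcases LQ with ⟨h, -⟩ | ⟨-, h, -⟩ | ⟨-, -, -, e⟩ | ⟨-, -, -, -, e⟩ | ⟨-, -, h1, h2, -⟩ |
        ⟨-, -, h1, h2, -⟩
      · exact absurd h33 h
      · exact absurd h23 h
      any_goals omega
      all_goals exact ⟨h1, h2⟩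
    have b1 := h.deg_one
    have b0 := h.deg_F
    simp only [h33, h23, hzero.1, hzero.2, map_zero, zero_mul, zero_add] at hQ
    refine h.natDegree_r_dichotomy hp₂ ?_ ?_ ?_ hz₁ hz₂ hQ
    all_goals
      rw [← Nat.lt_succ_iff]
      (repeat' with_reducible first
        | apply natDegree_add_lt | apply natDegree_C_mul_lt | apply natDegree_C_lt)
      all_goals omega
  · exact Dominated.of_left (by omega) (by omega) (by omega) (by omega)

end Growth

end Degree

/-- The degree conditions on a one-parameter specialization `L` of `k[x₁, x₂, x₃]`. -/
def IsDominated (L : MvPolynomial (Fin 3) k →ₐ[k] Polynomial k) : Prop :=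
  Dominated (L (X 0)) (L (X 1)) (L (X 2)) (L fP) (L rP) (L gP)

lemma algHom_C_eq (L : MvPolynomial (Fin 3) k →ₐ[k] Polynomial k) (c : k) :
    L (C c) = Polynomial.C c := by
  rw [← MvPolynomial.algebraMap_eq, L.commutes, Polynomial.algebraMap_eq]

lemma IsDominated.growth {L : MvPolynomial (Fin 3) k →ₐ[k] Polynomial k} (h : IsDominated L)
    {u : k} (hu : u ≠ 0) :
    Growth (L fP).natDegree ((L fP).natDegree + (L gP).natDegree)
      (L (expHom u (X 0))) (L (expHom u (X 1))) (L (expHom u (X 2))) (L fP) := by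
  obtain ⟨hf, hr, h1, h2, h3⟩ := h
  have hx1 := h1.le
  have hx2 := h2.le
  have hx3 := h3.le
  have hr' := hr.le
  have hf' := le_refl (L fP).natDegree
  have hg' := le_refl (L gP).natDegree
  have hfn : ∀ i, (L fP ^ i).natDegree = i * (L fP).natDegree := fun i => Polynomial.natDegree_pow _ _
  have hgn : ∀ i, (L gP ^ i).natDegree = i * (L gP).natDegree := fun i => Polynomial.natDegree_pow _ _
  have hF := algHom_fP (L.comp (expHom u))
  have hR := algHom_rP (L.comp (expHom u))
  have hG := algHom_gP (L.comp (expHom u))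
  simp only [AlgHom.comp_apply, expHom_fP, expHom_rP, expHom_gP] at hF hR hG
  refine ⟨hf, by omega, rfl, ?_, ?_, ?_, hF, ?_, ?_⟩
  · have : L (expHom u (X 0)) = Polynomial.C (u ^ 2) * (L fP ^ 2 * L gP) +
        (L (X 0) + Polynomial.C (-2 * u) * (L rP * L fP)) := by
      rw [expHom_X0]
      simp only [map_add, map_sub, map_mul, map_pow, map_neg, map_ofNat, algHom_C_eq]
      ring
    rw [this]
    refine natDegree_C_mul_add (pow_ne_zero _ hu) ?_ ?_
    · rw [natDegree_mul_pos (by rw [hfn]; omega) (by omega), hfn]; omega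
    · (repeat' with_reducible first
        | apply natDegree_add_lt | apply natDegree_C_mul_lt | apply natDegree_C_lt)
      all_goals
        apply lt_of_le_of_lt
        · (repeat' with_reducible first
            | assumption | apply Polynomial.natDegree_mul_le_of_le)
        · omega
  · have : L (expHom u (X 1)) = Polynomial.C (-u ^ 4) * (L fP ^ 3 * L gP ^ 2) +
        (L (X 1) + (Polynomial.C (4 * u) * (L (X 0) * L rP) + (Polynomial.C (-u) * L gP +
        (Polynomial.C (-4 * u ^ 2) * (L rP ^ 2 * L fP) +
        (Polynomial.C (-2 * u ^ 2) * (L (X 0) * L fP * L gP) +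
        Polynomial.C (4 * u ^ 3) * (L rP * L fP ^ 2 * L gP)))))) := by
      rw [expHom_X1]
      simp only [map_add, map_sub, map_mul, map_pow, map_neg, map_ofNat, algHom_C_eq]
      ring
    rw [this]
    refine natDegree_C_mul_add (neg_ne_zero.2 (pow_ne_zero _ hu)) ?_ ?_
    · rw [natDegree_mul_pos (by rw [hfn]; omega) (by rw [hgn]; omega), hfn, hgn]; omega
    · (repeat' with_reducible first
        | apply natDegree_add_lt | apply natDegree_C_mul_lt | apply natDegree_C_lt)
      all_goals
        apply lt_of_le_of_lt
        · (repeat' with_reducible first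
            | assumption | apply Polynomial.natDegree_mul_le_of_le
            | apply Polynomial.natDegree_pow_le_of_le)
        · omega
  · have : L (expHom u (X 2)) = Polynomial.C (u ^ 6) * (L fP ^ 4 * L gP ^ 3) +
        (L (X 2) + (Polynomial.C (6 * u) * (L (X 1) * L rP) + (Polynomial.C (2 * u) * L fP ^ 2 +
        (Polynomial.C (12 * u ^ 2) * (L (X 0) * L rP ^ 2) +
        (Polynomial.C (-3 * u ^ 2) * (L rP * L gP) +
        (Polynomial.C (-3 * u ^ 2) * (L (X 1) * L fP * L gP) +
        (Polynomial.C (-8 * u ^ 3) * (L rP ^ 3 * L fP) +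
        (Polynomial.C (-12 * u ^ 3) * (L (X 0) * L rP * L fP * L gP) +
        (Polynomial.C (2 * u ^ 3) * (L fP * L gP ^ 2) +
        (Polynomial.C (12 * u ^ 4) * (L rP ^ 2 * L fP ^ 2 * L gP) +
        (Polynomial.C (3 * u ^ 4) * (L (X 0) * L fP ^ 2 * L gP ^ 2) +
        Polynomial.C (-6 * u ^ 5) * (L rP * L fP ^ 3 * L gP ^ 2)))))))))))) := by
      rw [expHom_X2]
      simp only [map_add, map_sub, map_mul, map_pow, map_neg, map_ofNat, algHom_C_eq]
      ring
    rw [this]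
    refine natDegree_C_mul_add (pow_ne_zero _ hu) ?_ ?_
    · rw [natDegree_mul_pos (by rw [hfn]; omega) (by rw [hgn]; omega), hfn, hgn]; omega
    · (repeat' with_reducible first
        | apply natDegree_add_lt | apply natDegree_C_mul_lt | apply natDegree_C_lt)
      all_goals
        apply lt_of_le_of_lt
        · (repeat' with_reducible first
            | assumption | apply Polynomial.natDegree_mul_le_of_le
            | apply Polynomial.natDegree_pow_le_of_le)
        · omega
  · rw [← hR]
    have : L (rP - C u * fP * gP) = L rP + Polynomial.C (-u) * (L fP * L gP) := by
      simp only [map_sub, map_mul, map_neg, algHom_C_eq]; ring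
    rw [this, ← Nat.lt_succ_iff]
    exact natDegree_add_lt (by omega)
      (natDegree_C_mul_lt _ (Nat.lt_succ_of_le Polynomial.natDegree_mul_le))
  · rw [← hG]; omega

/-- The affine endomorphisms `x_i ↦ ∑_j a_{j,i} x_j + b_i` with `A ∈ GL₃(k)`. -/
def IsAffineHom (α : MvPolynomial (Fin 3) k →ₐ[k] MvPolynomial (Fin 3) k) : Prop :=
  ∃ (A : Matrix (Fin 3) (Fin 3) k) (b : Fin 3 → k), IsUnit A.det ∧
    ∀ i : Fin 3, α (X i) = (∑ j : Fin 3, C (A j i) * X j) + C (b i)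

/-- The one-parameter torus normalizing the flow `exp (uΔ)`. -/
def IsTorusHom (w : k) (β : MvPolynomial (Fin 3) k →ₐ[k] MvPolynomial (Fin 3) k) : Prop :=
  β (X 0) = C (w ^ 3) * X 0 ∧ β (X 1) = C (w ^ 2) * X 1 ∧ β (X 2) = C w * X 2

lemma IsDominated.comp [CharZero k] {L : MvPolynomial (Fin 3) k →ₐ[k] Polynomial k}
    (h : IsDominated L) {u : k} (hu : u ≠ 0)
    {α : MvPolynomial (Fin 3) k →ₐ[k] MvPolynomial (Fin 3) k} (hα : IsAffineHom α)
    (hne : ∀ w, w ≠ 0 → ¬ IsTorusHom w α) : IsDominated ((L.comp (expHom u)).comp α) := by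
  obtain ⟨A, b, hA, hX⟩ := hα
  have hz : ∀ i, ((L.comp (expHom u)).comp α) (X i) = Polynomial.C (A 2 i) * L (expHom u (X 2)) +
      (Polynomial.C (A 1 i) * L (expHom u (X 1)) +
      (Polynomial.C (A 0 i) * L (expHom u (X 0)) + Polynomial.C (b i))) := by
    intro i
    have hC := algHom_C_eq (L.comp (expHom u))
    simp only [AlgHom.comp_apply] at hC
    simp only [AlgHom.comp_apply, hX, Fin.sum_univ_three, map_add, map_mul, hC]
    ring
  have hf := algHom_fP ((L.comp (expHom u)).comp α)
  have hdet := hA.ne_zero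
  rw [Matrix.det_fin_three] at hdet
  rw [IsDominated, algHom_rP, algHom_gP]
  refine ((h.growth hu).torus_or_dominated (fun h0 => hdet ?_) (hz 0) (hz 1) (hz 2)
    hf).resolve_left ?_
  · linear_combination h0
  · rintro ⟨w, hw, ⟨h00, h10, h20, hb0⟩, ⟨h01, h11, h21, hb1⟩, h02, h12, h22, hb2⟩
    refine hne w hw ⟨?_, ?_, ?_⟩ <;> simp [Fin.sum_univ_three, *]

/-- The specialization `(x₁, x₂, x₃) ↦ (t, 0, t)`. -/
def evalDiag : MvPolynomial (Fin 3) k →ₐ[k] Polynomial k :=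
  aeval ![Polynomial.X, 0, Polynomial.X]

lemma isDominated_evalDiag : IsDominated (evalDiag : MvPolynomial (Fin 3) k →ₐ[k] _) := by
  have h0 : (evalDiag : MvPolynomial (Fin 3) k →ₐ[k] _) (X 0) = Polynomial.X := by simp [evalDiag]
  have h1 : (evalDiag : MvPolynomial (Fin 3) k →ₐ[k] _) (X 1) = 0 := by simp [evalDiag]
  have h2 : (evalDiag : MvPolynomial (Fin 3) k →ₐ[k] _) (X 2) = Polynomial.X := by simp [evalDiag]
  have hf : (evalDiag : MvPolynomial (Fin 3) k →ₐ[k] _) fP = Polynomial.X ^ 2 := by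
    rw [algHom_fP, h0, h1, h2]; ring
  have hr : (evalDiag : MvPolynomial (Fin 3) k →ₐ[k] _) rP = Polynomial.X ^ 2 := by
    rw [algHom_rP, h0, h1]; ring
  have hg : (evalDiag : MvPolynomial (Fin 3) k →ₐ[k] _) gP = Polynomial.X ^ 5 + Polynomial.X ^ 3 := by
    rw [algHom_gP, h0, h1, h2, hf]; ring
  have dg : (Polynomial.X ^ 5 + Polynomial.X ^ 3 : Polynomial k).natDegree = 5 := by compute_degree!
  rw [IsDominated, h0, h1, h2, hf, hr, hg]
  constructor <;> simp [dg]

/-- The affine endomorphism `x_i ↦ ∑_j a_{j,i} x_j + b_i`. -/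
def affineHom (A : Matrix (Fin 3) (Fin 3) k) (b : Fin 3 → k) :
    MvPolynomial (Fin 3) k →ₐ[k] MvPolynomial (Fin 3) k :=
  aeval fun i => (∑ j, C (A j i) * X j) + C (b i)

lemma affineHom_comp (A B : Matrix (Fin 3) (Fin 3) k) (a b : Fin 3 → k) :
    (affineHom A a).comp (affineHom B b) = affineHom (A * B) (b + Matrix.vecMul a B) := by
  apply MvPolynomial.algHom_ext
  intro i
  simp only [affineHom, AlgHom.comp_apply, aeval_X, map_add, map_mul, Matrix.mul_apply,
    Matrix.vecMul, dotProduct, Pi.add_apply, Fin.sum_univ_three, algHom_C, algebraMap_eq]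
  ring

lemma affineHom_one : affineHom (1 : Matrix (Fin 3) (Fin 3) k) 0 = AlgHom.id k _ := by
  apply MvPolynomial.algHom_ext
  intro i
  simp [affineHom, Matrix.one_apply, apply_ite C]

lemma isAffineHom_iff {α : MvPolynomial (Fin 3) k →ₐ[k] MvPolynomial (Fin 3) k} :
    IsAffineHom α ↔ ∃ A b, IsUnit A.det ∧ α = affineHom A b := by
  refine exists_congr fun A => exists_congr fun b => and_congr_right fun _ => ⟨fun h => ?_, ?_⟩
  · apply MvPolynomial.algHom_ext
    intro i
    simp [affineHom, h]
  · rintro rfl i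
    simp [affineHom]

lemma isAffineHom_id : IsAffineHom (AlgHom.id k (MvPolynomial (Fin 3) k)) :=
  isAffineHom_iff.2 ⟨1, 0, by simp, affineHom_one.symm⟩

lemma IsAffineHom.comp {α β : MvPolynomial (Fin 3) k →ₐ[k] MvPolynomial (Fin 3) k}
    (hα : IsAffineHom α) (hβ : IsAffineHom β) : IsAffineHom (α.comp β) := by
  obtain ⟨A, a, hA, rfl⟩ := isAffineHom_iff.1 hα
  obtain ⟨B, b, hB, rfl⟩ := isAffineHom_iff.1 hβ
  exact isAffineHom_iff.2 ⟨_, _, by rw [Matrix.det_mul]; exact hA.mul hB, affineHom_comp A B a b⟩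

lemma IsAffineHom.exists_inverse {α : MvPolynomial (Fin 3) k →ₐ[k] MvPolynomial (Fin 3) k}
    (hα : IsAffineHom α) :
    ∃ β, IsAffineHom β ∧ α.comp β = AlgHom.id k _ ∧ β.comp α = AlgHom.id k _ := by
  obtain ⟨A, a, hA, rfl⟩ := isAffineHom_iff.1 hα
  refine ⟨affineHom A⁻¹ (-Matrix.vecMul a A⁻¹),
    isAffineHom_iff.2 ⟨_, _, (Matrix.isUnit_nonsing_inv_det_iff).2 hA, rfl⟩, ?_, ?_⟩
  · rw [affineHom_comp, Matrix.mul_nonsing_inv _ hA, neg_add_cancel, affineHom_one]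
  · rw [affineHom_comp, Matrix.nonsing_inv_mul _ hA, Matrix.neg_vecMul, Matrix.vecMul_vecMul,
      Matrix.nonsing_inv_mul _ hA, Matrix.vecMul_one, add_neg_cancel, affineHom_one]

/-- Compositions `φ_{u₁} α₁ ⋯ φ_{u_l} α_l` of flows with affine maps outside the torus. -/
inductive IsReduced : (MvPolynomial (Fin 3) k →ₐ[k] MvPolynomial (Fin 3) k) → Prop
  | id : IsReduced (AlgHom.id k _)
  | comp {V : MvPolynomial (Fin 3) k →ₐ[k] MvPolynomial (Fin 3) k} {u : k}
      {α : MvPolynomial (Fin 3) k →ₐ[k] MvPolynomial (Fin 3) k} (hV : IsReduced V) (hu : u ≠ 0)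
      (hα : IsAffineHom α) (hne : ∀ w, w ≠ 0 → ¬ IsTorusHom w α) :
      IsReduced ((V.comp (expHom u)).comp α)

lemma IsReduced.isDominated [CharZero k] {V : MvPolynomial (Fin 3) k →ₐ[k] MvPolynomial (Fin 3) k}
    (hV : IsReduced V) : IsDominated (evalDiag.comp V) := by
  induction hV with
  | id => exact isDominated_evalDiag
  | comp _ hu hα hne ih => exact ih.comp hu hα hne

/-- Normal forms of the elements of the group generated by the flow and the affine maps. -/
def IsNormalForm (F : MvPolynomial (Fin 3) k →ₐ[k] MvPolynomial (Fin 3) k) : Prop :=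
  IsAffineHom F ∨ ∃ (α₀ V α₁ : MvPolynomial (Fin 3) k →ₐ[k] MvPolynomial (Fin 3) k) (u : k),
    IsAffineHom α₀ ∧ IsReduced V ∧ u ≠ 0 ∧ IsAffineHom α₁ ∧
      F = ((α₀.comp V).comp (expHom u)).comp α₁

lemma IsNormalForm.comp_affine {F α : MvPolynomial (Fin 3) k →ₐ[k] MvPolynomial (Fin 3) k}
    (hF : IsNormalForm F) (hα : IsAffineHom α) : IsNormalForm (F.comp α) := by
  obtain hF | ⟨α₀, V, α₁, u, h₀, hV, hu, h₁, rfl⟩ := hF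
  · exact Or.inl (hF.comp hα)
  · exact Or.inr ⟨α₀, V, α₁.comp α, u, h₀, hV, hu, h₁.comp hα, rfl⟩

lemma IsNormalForm.comp_expHom {F : MvPolynomial (Fin 3) k →ₐ[k] MvPolynomial (Fin 3) k}
    (hF : IsNormalForm F) {v : k} (hv : v ≠ 0) : IsNormalForm (F.comp (expHom v)) := by
  obtain hF | ⟨α₀, V, α₁, u, h₀, hV, hu, h₁, rfl⟩ := hF
  · exact Or.inr ⟨F, _, _, v, hF, .id, hv, isAffineHom_id, rfl⟩
  by_cases hβ : ∀ w, w ≠ 0 → ¬ IsTorusHom w α₁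
  · exact Or.inr ⟨α₀, _, _, v, h₀, hV.comp hu h₁ hβ, hv, isAffineHom_id, rfl⟩
  push Not at hβ
  obtain ⟨w, -, h0, h1, h2⟩ := hβ
  have key : (((α₀.comp V).comp (expHom u)).comp α₁).comp (expHom v) =
      ((α₀.comp V).comp (expHom (u + v * w ^ 7))).comp α₁ := by
    rw [← expHom_comp, AlgHom.comp_assoc, expHom_comm h0 h1 h2]
    rfl
  rw [key]
  by_cases h : u + v * w ^ 7 = 0
  · rw [h, expHom_zero]
    cases hV with
    | id => exact Or.inl (h₀.comp h₁)
    | comp hV' hu' hα' _ => exact Or.inr ⟨α₀, _, _, _, h₀, hV', hu', hα'.comp h₁, rfl⟩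
  · exact Or.inr ⟨α₀, V, α₁, _, h₀, hV, h, h₁, rfl⟩

lemma isNormalForm_of_mem_closure {φ : MvPolynomial (Fin 3) k ≃ₐ[k] MvPolynomial (Fin 3) k}
    (hφ : (φ : MvPolynomial (Fin 3) k →ₐ[k] _) = expHom 1)
    {F : MvPolynomial (Fin 3) k ≃ₐ[k] MvPolynomial (Fin 3) k}
    (hF : F ∈ Subgroup.closure ({φ} ∪ AffSet)) :
    IsNormalForm (F : MvPolynomial (Fin 3) k →ₐ[k] MvPolynomial (Fin 3) k) := by
  have inv_eq {a : MvPolynomial (Fin 3) k ≃ₐ[k] MvPolynomial (Fin 3) k}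
      {b : MvPolynomial (Fin 3) k →ₐ[k] MvPolynomial (Fin 3) k}
      (h : (a : MvPolynomial (Fin 3) k →ₐ[k] _).comp b = AlgHom.id k _) :
      ((a⁻¹ : MvPolynomial (Fin 3) k ≃ₐ[k] MvPolynomial (Fin 3) k) :
        MvPolynomial (Fin 3) k →ₐ[k] _) = b := by
    ext1 i
    exact a.symm_apply_eq.2 (DFunLike.congr_fun h (X i)).symm
  induction hF using Subgroup.closure_induction_right with
  | one => exact Or.inl isAffineHom_id
  | mul_right a _ b hb ih =>
    obtain rfl | hb := hb
    · have := ih.comp_expHom (v := 1) one_ne_zero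
      rwa [← hφ] at this
    · exact ih.comp_affine (show IsAffineHom (b : MvPolynomial (Fin 3) k →ₐ[k] _) from hb)
  | mul_inv_cancel a _ b hb ih =>
    obtain rfl | hb := hb
    · have := ih.comp_expHom (v := -1) (neg_ne_zero.2 one_ne_zero)
      rwa [← inv_eq (b := expHom (-1)) (by rw [hφ, expHom_comp, add_neg_cancel, expHom_zero])] at this
    · obtain ⟨β, hβ, hc, -⟩ := (show IsAffineHom (b : MvPolynomial (Fin 3) k →ₐ[k] _) from hb).exists_inverse
      have := ih.comp_affine hβ
      rwa [← inv_eq hc] at this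

/-- The elementary automorphism `(x₁, x₂, x₃ + x₁²)`. -/
def elemEquiv : MvPolynomial (Fin 3) k ≃ₐ[k] MvPolynomial (Fin 3) k :=
  AlgEquiv.ofAlgHom (aeval ![X 0, X 1, X 2 + X 0 ^ 2]) (aeval ![X 0, X 1, X 2 - X 0 ^ 2])
    (by ext1 i; fin_cases i <;> simp) (by ext1 i; fin_cases i <;> simp)

lemma elemEquiv_X0 : elemEquiv (X 0 : MvPolynomial (Fin 3) k) = X 0 := by simp [elemEquiv]

lemma elemEquiv_X1 : elemEquiv (X 1 : MvPolynomial (Fin 3) k) = X 1 := by simp [elemEquiv]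

lemma elemEquiv_X2 : elemEquiv (X 2 : MvPolynomial (Fin 3) k) = X 2 + X 0 ^ 2 := by
  simp [elemEquiv]

lemma elemEquiv_mem_TA : (elemEquiv : MvPolynomial (Fin 3) k ≃ₐ[k] _) ∈ (TA : Subgroup _) := by
  refine Subgroup.subset_closure (Or.inr ⟨1, ![0, 0, X 0 ^ 2], by simp, fun i => ?_, fun i => ?_⟩)
  · fin_cases i
    · exact zero_mem _
    · exact zero_mem _
    · exact pow_mem (MvPolynomial.X_mem_supported.2 (by simp)) 2
  · fin_cases i <;> simp [elemEquiv]

lemma IsAffineHom.natDegree_le {α : MvPolynomial (Fin 3) k →ₐ[k] MvPolynomial (Fin 3) k}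
    (hα : IsAffineHom α) {L : MvPolynomial (Fin 3) k →ₐ[k] Polynomial k} {N : ℕ}
    (hL : ∀ i, (L (X i)).natDegree ≤ N) (i : Fin 3) : (L (α (X i))).natDegree ≤ N := by
  obtain ⟨A, b, -, h⟩ := hα
  rw [h, map_add, map_sum, algHom_C_eq]
  refine Polynomial.natDegree_add_le_of_degree_le
    (Polynomial.natDegree_sum_le_of_forall_le _ _ fun j _ => ?_) (by simp)
  rw [map_mul, algHom_C_eq]
  exact (Polynomial.natDegree_C_mul_le _ _).trans (hL j)

lemma not_isNormalForm_elemEquiv [CharZero k] :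
    ¬ IsNormalForm
      (elemEquiv (k := k) : MvPolynomial (Fin 3) k →ₐ[k] MvPolynomial (Fin 3) k) := by
  have hdiag (i : Fin 3) :
      ((evalDiag : MvPolynomial (Fin 3) k →ₐ[k] _) (X i)).natDegree ≤ 1 := by
    fin_cases i <;> simp [evalDiag]
  rintro (h | ⟨α₀, V, α₁, u, h₀, hV, hu, h₁, h⟩)
  · have := h.natDegree_le hdiag 2
    have hX : evalDiag ((elemEquiv (k := k) : MvPolynomial (Fin 3) k →ₐ[k] MvPolynomial (Fin 3) k) (X 2)) =
        (Polynomial.X + Polynomial.X ^ 2 : Polynomial k) := by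
      simp [elemEquiv_X2, evalDiag]
    have hd : (Polynomial.X + Polynomial.X ^ 2 : Polynomial k).natDegree = 2 := by
      compute_degree!
    rw [hX, hd] at this
    omega
  · obtain ⟨β₀, hβ₀, -, hβα⟩ := h₀.exists_inverse
    obtain ⟨β₁, hβ₁, hαβ, -⟩ := h₁.exists_inverse
    have key : V (expHom u (X 0)) = β₀ (elemEquiv (β₁ (X 0))) := by
      have e := DFunLike.congr_fun h (β₁ (X 0))
      have e₁ := DFunLike.congr_fun hαβ (X 0)
      have e₀ := DFunLike.congr_fun hβα (V (expHom u (X 0)))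
      simp only [AlgHom.comp_apply, AlgHom.id_apply] at e e₁ e₀
      rw [e₁] at e
      rw [← e₀, ← e]
      rfl
    have hgrow := hV.isDominated.growth hu
    have h1 := hgrow.deg_one
    have h2 := hgrow.n_pos
    have h3 := hgrow.n_lt
    have hdeg (i : Fin 3) : (((evalDiag.comp β₀).comp
        (elemEquiv (k := k) : MvPolynomial (Fin 3) k →ₐ[k] MvPolynomial (Fin 3) k)) (X i)).natDegree ≤ 2 := by
      have hd (i : Fin 3) := hβ₀.natDegree_le hdiag i
      fin_cases i
      · simpa [elemEquiv_X0] using (hd 0).trans one_le_two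
      · simpa [elemEquiv_X1] using (hd 1).trans one_le_two
      · simpa [elemEquiv_X2] using Polynomial.natDegree_add_le_of_degree_le
          ((hd 2).trans one_le_two) (Polynomial.natDegree_pow_le_of_le 2 (hd 0))
    have := hβ₁.natDegree_le hdeg 0
    rw [AlgHom.comp_apply, key] at h1
    change (evalDiag (β₀ (elemEquiv (β₁ (X 0))))).natDegree ≤ 2 at this
    omega

/-- The exponential automorphism `φ = exp Δ` is not co-tame:
the subgroup `⟨φ, Aff_3(k)⟩` does not contain the tame subgroup `TA_3(k)`. -/
theorem statement0 [CharZero k]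
    (hln : ∀ h : MvPolynomial (Fin 3) k, ∃ l : ℕ, Del^[l] h = 0)
    (φ : MvPolynomial (Fin 3) k ≃ₐ[k] MvPolynomial (Fin 3) k)
    (hφ : IsExpOf Del φ) :
    ¬ (TA ≤ Subgroup.closure ({φ} ∪ AffSet)) := fun h =>
  not_isNormalForm_elemEquiv (isNormalForm_of_mem_closure hφ.eq_expHom (h elemEquiv_mem_TA))

end YasudaPaper
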